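/- arXiv:2406.10919 — 3 statements merged into one kernel-verified Lean document; each statement's English description precedes it below -/
import Mathlib

section
/- Let α > 1 be a real number. For Lebesgue-almost all x ∈ (0,1], writing x = ⟨d_i⟩_α for its α-expansion, the asymptotic arithmetic mean of the digits satisfies lim_{n→∞} (d_1 + d_2 + ⋯ + d_n)/n = α/(α−1). -/
open MeasureTheory Filter

/-- The α-expansion value ⟨d_i⟩_α = ∑_{i=1}^∞ (α-1)^{i-1} α^{-(d_1+⋯+d_i)},
with the digit sequence `d : ℕ → ℕ` indexed from 0 (so `d 0` is the first digit). -/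
noncomputable def alphaExpansion (α : ℝ) (d : ℕ → ℕ) : ℝ :=
  ∑' i : ℕ, (α - 1) ^ i * α ^ (-((∑ j ∈ Finset.range (i + 1), d j : ℕ) : ℤ))

namespace AlphaExpansion

open ProbabilityTheory Set

/-- The first digit of the `α`-expansion of `x`: the `n` with `α ^ (-n) < x ≤ α ^ (-n + 1)`. -/
noncomputable def digit (α x : ℝ) : ℕ := ⌊-Real.logb α x⌋₊ + 1

/-- The map which drops the first digit of an `α`-expansion. -/
noncomputable def shift (α x : ℝ) : ℝ := (α ^ digit α x * x - 1) / (α - 1)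

/-- Lebesgue measure on `(0, 1]`. -/
noncomputable abbrev unitMeasure : Measure ℝ := volume.restrict (Ioc (0 : ℝ) 1)

instance isProbabilityMeasure_unitMeasure : IsProbabilityMeasure unitMeasure :=
  ⟨by simp [unitMeasure]⟩

lemma measurable_digit (α : ℝ) : Measurable (digit α) := by
  unfold digit Real.logb
  fun_prop

lemma measurable_shift (α : ℝ) : Measurable (shift α) := by
  have := measurable_digit α
  unfold shift
  fun_prop

variable {α : ℝ}

lemma digit_eq_succ_iff (hα : 1 < α) {x : ℝ} (hx : x ∈ Ioc (0 : ℝ) 1) (k : ℕ) :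
    digit α x = k + 1 ↔ (α ^ (k + 1))⁻¹ < x ∧ x ≤ (α ^ k)⁻¹ := by
  have h0 : 0 ≤ -Real.logb α x := by
    have := Real.logb_nonpos hα hx.1.le hx.2
    linarith
  have h1 : (k : ℝ) ≤ -Real.logb α x ↔ x ≤ (α ^ k)⁻¹ := by
    rw [le_neg, Real.logb_le_iff_le_rpow hα hx.1, Real.rpow_neg (by linarith), Real.rpow_natCast]
  have h2 : -Real.logb α x < (k : ℝ) + 1 ↔ (α ^ (k + 1))⁻¹ < x := by
    rw [neg_lt, Real.lt_logb_iff_rpow_lt hα hx.1, Real.rpow_neg (by linarith)]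
    norm_cast
  rw [digit, Nat.add_right_cancel_iff, Nat.floor_eq_iff h0, h1, h2, and_comm]

/-- On each digit cylinder the shift is an affine map onto `(0, 1]`. -/
lemma cylinder_inter_preimage_shift (hα : 1 < α) (k : ℕ) (t : Set ℝ) :
    digit α ⁻¹' {k + 1} ∩ shift α ⁻¹' t ∩ Ioc 0 1 =
      (fun x => α ^ (k + 1) / (α - 1) * x) ⁻¹'
        ((fun x => x + -(1 / (α - 1))) ⁻¹' (t ∩ Ioc 0 1)) := by
  have hα' : 0 < α - 1 := by linarith
  have hp : 0 < α ^ k := by positivity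
  have hp1 : 1 ≤ α ^ k := one_le_pow₀ hα.le
  have key : ∀ x : ℝ, α ^ (k + 1) / (α - 1) * x + -(1 / (α - 1)) =
      (α ^ (k + 1) * x - 1) / (α - 1) := fun x => by ring
  have lower : ∀ x : ℝ, (α ^ (k + 1))⁻¹ < x ↔ 0 < (α ^ (k + 1) * x - 1) / (α - 1) := fun x => by
    rw [inv_lt_iff_one_lt_mul₀' (by positivity), lt_div_iff₀ hα', zero_mul, sub_pos]
  have upper : ∀ x : ℝ, x ≤ (α ^ k)⁻¹ ↔ (α ^ (k + 1) * x - 1) / (α - 1) ≤ 1 := fun x => by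
    rw [div_le_one hα', sub_le_sub_iff_right, pow_succ', mul_assoc,
      mul_le_iff_le_one_right (by linarith), ← one_div, le_div_iff₀' hp]
  ext x
  simp only [mem_inter_iff, mem_preimage, mem_singleton_iff, key]
  constructor
  · rintro ⟨⟨hd, ht⟩, hx⟩
    have hk := (digit_eq_succ_iff hα hx k).1 hd
    rw [shift, hd] at ht
    exact ⟨ht, (lower x).1 hk.1, (upper x).1 hk.2⟩
  · rintro ⟨ht, h1, h2⟩
    have hl := (lower x).2 h1
    have hu := (upper x).2 h2
    have hx : x ∈ Ioc (0 : ℝ) 1 :=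
      ⟨lt_trans (by positivity) hl, hu.trans (inv_le_one_of_one_le₀ hp1)⟩
    have hd := (digit_eq_succ_iff hα hx k).2 ⟨hl, hu⟩
    refine ⟨⟨hd, ?_⟩, hx⟩
    rwa [shift, hd]

lemma unitMeasure_cylinder_inter (hα : 1 < α) (k : ℕ) {t : Set ℝ} (ht : MeasurableSet t) :
    unitMeasure (digit α ⁻¹' {k + 1} ∩ shift α ⁻¹' t) =
      ENNReal.ofReal ((α - 1) * α⁻¹ ^ (k + 1)) * unitMeasure t := by
  have hα' : 0 < α - 1 := by linarith
  have hc : 0 < α ^ (k + 1) / (α - 1) := by positivity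
  rw [Measure.restrict_apply ((measurable_digit α (measurableSet_singleton _)).inter
      (measurable_shift α ht)), cylinder_inter_preimage_shift hα,
    Real.volume_preimage_mul_left hc.ne', measure_preimage_add_right,
    Measure.restrict_apply ht, abs_of_pos (inv_pos.2 hc), inv_div, div_eq_mul_inv, inv_pow]

lemma unitMeasure_digit_eq_succ (hα : 1 < α) (k : ℕ) :
    unitMeasure (digit α ⁻¹' {k + 1}) = ENNReal.ofReal ((α - 1) * α⁻¹ ^ (k + 1)) := by
  simpa [measure_univ] using
    unitMeasure_cylinder_inter hα k MeasurableSet.univ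

lemma digit_preimage_zero : digit α ⁻¹' {0} = ∅ := by
  ext x
  simp [digit]

lemma unitMeasure_digit_inter_shift (hα : 1 < α) (s : Set ℕ) {t : Set ℝ} (ht : MeasurableSet t) :
    unitMeasure (digit α ⁻¹' s ∩ shift α ⁻¹' t) =
      unitMeasure (digit α ⁻¹' s) * unitMeasure t := by
  have h : (unitMeasure.restrict (shift α ⁻¹' t)).map (digit α) =
      unitMeasure t • unitMeasure.map (digit α) := by
    refine Measure.ext_of_singleton fun n => ?_
    have hm : MeasurableSet (digit α ⁻¹' {n}) := measurable_digit α (measurableSet_singleton n)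
    rw [Measure.map_apply (measurable_digit α) (measurableSet_singleton n),
      Measure.restrict_apply hm, Measure.smul_apply,
      Measure.map_apply (measurable_digit α) (measurableSet_singleton n), smul_eq_mul]
    cases n with
    | zero => simp [digit_preimage_zero]
    | succ k => rw [unitMeasure_cylinder_inter hα k ht, unitMeasure_digit_eq_succ hα, mul_comm]
  have hs : MeasurableSet s := MeasurableSet.of_discrete
  have := congrArg (fun ν : Measure ℕ => ν s) h
  simp only [Measure.smul_apply, Measure.map_apply (measurable_digit α) hs, smul_eq_mul] at this
  rwa [Measure.restrict_apply (measurable_digit α hs), mul_comm (unitMeasure t)] at this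

lemma measurePreserving_shift (hα : 1 < α) :
    MeasurePreserving (shift α) unitMeasure unitMeasure := by
  refine ⟨measurable_shift α, Measure.ext fun t ht => ?_⟩
  rw [Measure.map_apply (measurable_shift α) ht]
  simpa [measure_univ] using
    unitMeasure_digit_inter_shift hα univ ht

lemma indepFun_digit_shift (hα : 1 < α) : digit α ⟂ᵢ[unitMeasure] shift α := by
  refine indepFun_iff_measure_inter_preimage_eq_mul.2 fun s t _ ht => ?_
  rw [unitMeasure_digit_inter_shift hα s ht,
    (measurePreserving_shift hα).measure_preimage ht.nullMeasurableSet]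

/-- The random variable giving the digit of index `i` (counted from `0`). -/
noncomputable def digitAt (α : ℝ) (i : ℕ) (x : ℝ) : ℝ := digit α ((shift α)^[i] x)

lemma measurable_digitAt (i : ℕ) : Measurable (digitAt α i) :=
  measurable_from_nat.comp ((measurable_digit α).comp ((measurable_shift α).iterate i))

lemma indepFun_digitAt_of_lt (hα : 1 < α) {i j : ℕ} (hij : i < j) :
    digitAt α i ⟂ᵢ[unitMeasure] digitAt α j := by
  obtain ⟨m, rfl⟩ := Nat.exists_eq_add_of_lt hij
  have h : digitAt α 0 ⟂ᵢ[unitMeasure] (digitAt α m ∘ shift α) :=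
    (indepFun_digit_shift hα).comp (measurable_from_nat (f := fun n : ℕ => (n : ℝ)))
      (measurable_digitAt m)
  have hT := (measurePreserving_shift hα).iterate i
  have hi : digitAt α i = digitAt α 0 ∘ (shift α)^[i] := rfl
  have hj : digitAt α (i + m + 1) = (digitAt α m ∘ shift α) ∘ (shift α)^[i] := by
    ext x
    rw [show i + m + 1 = (m + 1) + i by omega, digitAt, Function.iterate_add_apply]
    rfl
  rw [indepFun_iff_measure_inter_preimage_eq_mul] at h ⊢
  intro s t hs ht
  have hs' := measurable_digitAt (α := α) 0 hs
  have ht' : MeasurableSet (digitAt α m ∘ shift α ⁻¹' t) :=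
    ((measurable_digitAt m).comp (measurable_shift α)) ht
  rw [hi, hj, preimage_comp, preimage_comp (f := (shift α)^[i]), ← preimage_inter,
    hT.measure_preimage (hs'.inter ht').nullMeasurableSet,
    hT.measure_preimage hs'.nullMeasurableSet, hT.measure_preimage ht'.nullMeasurableSet,
    h s t hs ht]

lemma pairwise_indepFun_digitAt (hα : 1 < α) :
    Pairwise (Function.onFun (· ⟂ᵢ[unitMeasure] ·) (digitAt α)) := by
  intro i j hij
  rcases hij.lt_or_gt with h | h
  · exact indepFun_digitAt_of_lt hα h
  · exact (indepFun_digitAt_of_lt hα h).symm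

lemma identDistrib_digitAt (hα : 1 < α) (i : ℕ) :
    IdentDistrib (digitAt α i) (digitAt α 0) unitMeasure unitMeasure := by
  have hT := (measurePreserving_shift hα).iterate i
  refine ⟨(measurable_digitAt i).aemeasurable, (measurable_digitAt 0).aemeasurable, ?_⟩
  conv_rhs => rw [← hT.map_eq, Measure.map_map (measurable_digitAt 0) hT.measurable]
  rfl

lemma hasSum_geometric_mean (hα : 1 < α) :
    HasSum (fun n : ℕ => (n : ℝ) * ((α - 1) * α⁻¹ ^ n)) (α / (α - 1)) := by
  have hα' : α - 1 ≠ 0 := by linarith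
  have hα0 : α ≠ 0 := by linarith
  have hr : ‖α⁻¹‖ < 1 := by
    rw [norm_inv, Real.norm_of_nonneg (by linarith)]
    exact inv_lt_one_of_one_lt₀ hα
  have hval : (α - 1) * (α⁻¹ / (1 - α⁻¹) ^ 2) = α / (α - 1) := by
    have : 1 - α⁻¹ = (α - 1) / α := by field_simp
    rw [this]
    field_simp
  have h := (hasSum_coe_mul_geometric_of_norm_lt_one hr).mul_left (α - 1)
  rw [hval] at h
  simpa only [mul_left_comm] using h

lemma lintegral_digitAt_zero (hα : 1 < α) :
    ∫⁻ x, ENNReal.ofReal (digitAt α 0 x) ∂unitMeasure = ENNReal.ofReal (α / (α - 1)) := by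
  have hα' : 0 < α - 1 := by linarith
  have hs := hasSum_geometric_mean hα
  have h : ∫⁻ n, ENNReal.ofReal (n : ℝ) ∂(unitMeasure.map (digit α)) =
      ∫⁻ x, ENNReal.ofReal (digitAt α 0 x) ∂unitMeasure :=
    lintegral_map measurable_from_nat (measurable_digit α)
  rw [← h, lintegral_countable', ← hs.tsum_eq,
    ENNReal.ofReal_tsum_of_nonneg (fun n => by positivity) hs.summable]
  refine tsum_congr fun n => ?_
  rw [Measure.map_apply (measurable_digit α) (measurableSet_singleton n)]
  cases n with
  | zero => simp
  | succ k => rw [unitMeasure_digit_eq_succ hα, ENNReal.ofReal_mul (Nat.cast_nonneg _)]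

lemma digitAt_nonneg (i : ℕ) (x : ℝ) : 0 ≤ digitAt α i x := Nat.cast_nonneg _

lemma integrable_digitAt_zero (hα : 1 < α) : Integrable (digitAt α 0) unitMeasure := by
  refine ⟨(measurable_digitAt 0).aestronglyMeasurable, ?_⟩
  rw [hasFiniteIntegral_iff_ofReal (ae_of_all _ (digitAt_nonneg 0)), lintegral_digitAt_zero hα]
  exact ENNReal.ofReal_lt_top

lemma integral_digitAt_zero (hα : 1 < α) :
    ∫ x, digitAt α 0 x ∂unitMeasure = α / (α - 1) := by
  rw [integral_eq_lintegral_of_nonneg_ae (ae_of_all _ (digitAt_nonneg 0))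
    (measurable_digitAt 0).aestronglyMeasurable, lintegral_digitAt_zero hα,
    ENNReal.toReal_ofReal (div_nonneg (by linarith) (by linarith))]

/-- The general term of the series `alphaExpansion α d`. -/
noncomputable def term (α : ℝ) (d : ℕ → ℕ) (i : ℕ) : ℝ :=
  (α - 1) ^ i * α ^ (-((∑ j ∈ Finset.range (i + 1), d j : ℕ) : ℤ))

lemma term_pos (hα : 1 < α) (d : ℕ → ℕ) (i : ℕ) : 0 < term α d i := by
  have : 0 < α - 1 := by linarith
  unfold term
  positivity

lemma term_le (hα : 1 < α) {d : ℕ → ℕ} (hd : ∀ i, 1 ≤ d i) (i : ℕ) :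
    term α d i ≤ α⁻¹ * ((α - 1) / α) ^ i := by
  have hα' : 0 < α - 1 := by linarith
  have hsum : i + 1 ≤ ∑ j ∈ Finset.range (i + 1), d j := by
    simpa using Finset.sum_le_sum (s := Finset.range (i + 1)) fun j _ => hd j
  calc term α d i ≤ (α - 1) ^ i * (α ^ (i + 1))⁻¹ := by
        rw [term, zpow_neg, zpow_natCast]
        gcongr
        exact hα.le
    _ = α⁻¹ * ((α - 1) / α) ^ i := by
        rw [div_pow, pow_succ, mul_inv]
        ring

lemma hasSum_majorant (hα : 1 < α) :
    HasSum (fun i : ℕ => α⁻¹ * ((α - 1) / α) ^ i) 1 := by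
  have hα0 : 0 < α := by linarith
  have h := (hasSum_geometric_of_lt_one (r := (α - 1) / α) (div_nonneg (by linarith) hα0.le)
    (by rw [div_lt_one hα0]; linarith)).mul_left α⁻¹
  have : 1 - (α - 1) / α = α⁻¹ := by
    field_simp
    ring
  rwa [this, inv_inv, inv_mul_cancel₀ hα0.ne'] at h

lemma summable_term (hα : 1 < α) {d : ℕ → ℕ} (hd : ∀ i, 1 ≤ d i) : Summable (term α d) :=
  .of_nonneg_of_le (fun i => (term_pos hα d i).le) (term_le hα hd) (hasSum_majorant hα).summable

lemma alphaExpansion_mem_Ioc (hα : 1 < α) {d : ℕ → ℕ} (hd : ∀ i, 1 ≤ d i) :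
    alphaExpansion α d ∈ Ioc (0 : ℝ) 1 :=
  ⟨(summable_term hα hd).tsum_pos (fun i => (term_pos hα d i).le) 0 (term_pos hα d 0),
    ((summable_term hα hd).tsum_le_tsum (term_le hα hd) (hasSum_majorant hα).summable).trans_eq
      (hasSum_majorant hα).tsum_eq⟩

lemma alphaExpansion_eq (hα : 1 < α) {d : ℕ → ℕ} (hd : ∀ i, 1 ≤ d i) :
    alphaExpansion α d =
      (α ^ d 0)⁻¹ * (1 + (α - 1) * alphaExpansion α (fun i => d (i + 1))) := by
  have hα0 : α ≠ 0 := by linarith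
  have hstep : ∀ i, term α d (i + 1) =
      (α ^ d 0)⁻¹ * (α - 1) * term α (fun i => d (i + 1)) i := fun i => by
    simp only [term]
    rw [Finset.sum_range_succ' d, Nat.cast_add, neg_add, zpow_add₀ hα0, zpow_neg _ (d 0 : ℤ),
      zpow_natCast, pow_succ]
    ring
  have h0 : term α d 0 = (α ^ d 0)⁻¹ := by simp [term]
  change ∑' i, term α d i = _ * (1 + _ * ∑' i, term α (fun i => d (i + 1)) i)
  rw [(summable_term hα hd).tsum_eq_zero_add, h0, tsum_congr hstep, tsum_mul_left]
  ring

lemma digit_alphaExpansion (hα : 1 < α) {d : ℕ → ℕ} (hd : ∀ i, 1 ≤ d i) :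
    digit α (alphaExpansion α d) = d 0 := by
  have hα' : 0 < α - 1 := by linarith
  obtain ⟨k, hk⟩ := Nat.exists_eq_add_of_le' (hd 0)
  have htail := alphaExpansion_mem_Ioc hα fun i => hd (i + 1)
  have hp : 0 < (α ^ (k + 1))⁻¹ := by positivity
  rw [hk, digit_eq_succ_iff hα (alphaExpansion_mem_Ioc hα hd), alphaExpansion_eq hα hd, hk]
  constructor
  · have := mul_pos hα' htail.1
    nlinarith
  · calc _ ≤ (α ^ (k + 1))⁻¹ * α := by
          gcongr
          nlinarith [htail.2]
      _ = (α ^ k)⁻¹ := by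
          rw [pow_succ]
          field_simp

lemma shift_alphaExpansion (hα : 1 < α) {d : ℕ → ℕ} (hd : ∀ i, 1 ≤ d i) :
    shift α (alphaExpansion α d) = alphaExpansion α fun i => d (i + 1) := by
  have hα' : α - 1 ≠ 0 := by linarith
  have hp : α ^ d 0 ≠ 0 := by positivity
  rw [shift, digit_alphaExpansion hα hd, alphaExpansion_eq hα hd, mul_inv_cancel_left₀ hp,
    add_sub_cancel_left, mul_div_cancel_left₀ _ hα']

lemma digitAt_alphaExpansion (hα : 1 < α) {d : ℕ → ℕ} (hd : ∀ i, 1 ≤ d i) (i : ℕ) :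
    digitAt α i (alphaExpansion α d) = d i := by
  induction i generalizing d with
  | zero => simp [digitAt, digit_alphaExpansion hα hd]
  | succ i ih =>
    rw [← ih fun i => hd (i + 1), digitAt, digitAt, Function.iterate_succ_apply,
      shift_alphaExpansion hα hd]

end AlphaExpansion

open AlphaExpansion in
theorem digit_arithmetic_mean_ae (α : ℝ) (hα : 1 < α) :
    ∀ᵐ x ∂(volume.restrict (Set.Ioc (0 : ℝ) 1)),
      ∀ d : ℕ → ℕ, (∀ i, 1 ≤ d i) → alphaExpansion α d = x →
        Tendsto (fun n : ℕ => (∑ i ∈ Finset.range n, (d i : ℝ)) / n)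
          atTop (nhds (α / (α - 1))) := by
  filter_upwards [ProbabilityTheory.strong_law_ae_real (digitAt α) (integrable_digitAt_zero hα)
    (pairwise_indepFun_digitAt hα) (identDistrib_digitAt hα)] with x hx d hd hdx
  rw [integral_digitAt_zero hα] at hx
  subst hdx
  simpa only [digitAt_alphaExpansion hα hd] using hx
end

section
/- Let α > 1 be a real number, let D be a nonempty proper subset of the positive integers, and let h ≥ 0 satisfy ∑_{i∈D} ((α−1)/α^i)^h = 1. Then the set I_α(D) = {⟨d_i⟩_α : d_i ∈ D for all i} of numbers whose α-expansion uses only digits from D has Hausdorff dimension h. -/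
open MeasureTheory

open scoped ENNReal NNReal Topology

open Filter Metric

/-! ### The `α`-expansion as the coding map of an iterated function system -/

/-- The contraction ratio of the branch with digit `k`. -/
noncomputable def branchRatio (α : ℝ) (k : ℕ) : ℝ := (α - 1) / α ^ k

lemma branchRatio_pos {α : ℝ} (hα : 1 < α) (k : ℕ) : 0 < branchRatio α k :=
  div_pos (by linarith) (by positivity)

lemma branchRatio_one_lt_one {α : ℝ} (hα : 1 < α) : branchRatio α 1 < 1 := by
  rw [branchRatio, pow_one, div_lt_one (by linarith)]
  linarith

lemma branchRatio_le_one {α : ℝ} (hα : 1 < α) {k : ℕ} (hk : 1 ≤ k) :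
    branchRatio α k ≤ branchRatio α 1 := by
  unfold branchRatio
  have : α ^ 1 ≤ α ^ k := pow_le_pow_right₀ hα.le hk
  gcongr

lemma prod_branchRatio_le {α : ℝ} (hα : 1 < α) {d : ℕ → ℕ} (hd : ∀ i, 1 ≤ d i) (n : ℕ) :
    ∏ j ∈ Finset.range n, branchRatio α (d j) ≤ branchRatio α 1 ^ n := by
  calc ∏ j ∈ Finset.range n, branchRatio α (d j)
      ≤ ∏ _j ∈ Finset.range n, branchRatio α 1 :=
        Finset.prod_le_prod (fun j _ => (branchRatio_pos hα _).le)
          fun j _ => branchRatio_le_one hα (hd j)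
    _ = branchRatio α 1 ^ n := by simp

/-- The `i`-th term of the series defining the `α`-expansion. -/
noncomputable def expansionTerm (α : ℝ) (d : ℕ → ℕ) (i : ℕ) : ℝ :=
  (α - 1) ^ i * α ^ (-((∑ j ∈ Finset.range (i + 1), d j : ℕ) : ℤ))

lemma expansionTerm_nonneg {α : ℝ} (hα : 1 < α) (d : ℕ → ℕ) (i : ℕ) :
    0 ≤ expansionTerm α d i := by
  have : 0 ≤ α - 1 := by linarith
  have : 0 < α := by linarith
  unfold expansionTerm
  positivity

lemma expansionTerm_le {α : ℝ} (hα : 1 < α) {d : ℕ → ℕ} (hd : ∀ i, 1 ≤ d i) (i : ℕ) :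
    expansionTerm α d i ≤ α⁻¹ * branchRatio α 1 ^ i := by
  have h0 : 0 ≤ α - 1 := by linarith
  have h1 : 0 < α := by linarith
  have hs : i + 1 ≤ ∑ j ∈ Finset.range (i + 1), d j := by
    simpa using Finset.sum_le_sum fun j (_ : j ∈ Finset.range (i + 1)) => hd j
  have hp : α ^ (i + 1) ≤ α ^ (∑ j ∈ Finset.range (i + 1), d j) := pow_le_pow_right₀ hα.le hs
  calc expansionTerm α d i = (α - 1) ^ i * (α ^ (∑ j ∈ Finset.range (i + 1), d j))⁻¹ := by
        rw [expansionTerm, zpow_neg, zpow_natCast]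
    _ ≤ (α - 1) ^ i * (α ^ (i + 1))⁻¹ := by gcongr
    _ = α⁻¹ * branchRatio α 1 ^ i := by
        rw [branchRatio, pow_one, div_pow, pow_succ]
        field_simp

lemma hasSum_geometric_bound {α : ℝ} (hα : 1 < α) :
    HasSum (fun i : ℕ => α⁻¹ * branchRatio α 1 ^ i) 1 := by
  have h := (hasSum_geometric_of_lt_one (branchRatio_pos hα 1).le
    (branchRatio_one_lt_one hα)).mul_left α⁻¹
  have hα0 : α ≠ 0 := by linarith
  have hval : α⁻¹ * (1 - branchRatio α 1)⁻¹ = 1 := by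
    rw [branchRatio, pow_one, ← mul_inv]
    field_simp
    ring
  rwa [hval] at h

lemma summable_expansionTerm {α : ℝ} (hα : 1 < α) {d : ℕ → ℕ} (hd : ∀ i, 1 ≤ d i) :
    Summable (expansionTerm α d) :=
  .of_nonneg_of_le (expansionTerm_nonneg hα d) (expansionTerm_le hα hd)
    (hasSum_geometric_bound hα).summable

lemma alphaExpansion_nonneg {α : ℝ} (hα : 1 < α) (d : ℕ → ℕ) : 0 ≤ alphaExpansion α d :=
  tsum_nonneg (expansionTerm_nonneg hα d)

lemma alphaExpansion_le_one {α : ℝ} (hα : 1 < α) {d : ℕ → ℕ} (hd : ∀ i, 1 ≤ d i) :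
    alphaExpansion α d ≤ 1 :=
  hasSum_le (expansionTerm_le hα hd) (summable_expansionTerm hα hd).hasSum
    (hasSum_geometric_bound hα)

lemma alphaExpansion_eq_shift {α : ℝ} (hα : 1 < α) {d : ℕ → ℕ} (hd : ∀ i, 1 ≤ d i) :
    alphaExpansion α d =
      (α ^ d 0)⁻¹ + branchRatio α (d 0) * alphaExpansion α (fun i => d (i + 1)) := by
  have hα0 : α ≠ 0 := by linarith
  have hterm (i : ℕ) : expansionTerm α d (i + 1) =
      branchRatio α (d 0) * expansionTerm α (fun i => d (i + 1)) i := by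
    simp only [expansionTerm, branchRatio, zpow_neg, zpow_natCast]
    rw [Finset.sum_range_succ' _ (i + 1), pow_add α, pow_succ (α - 1)]
    field_simp
  calc alphaExpansion α d = ∑' i, expansionTerm α d i := rfl
    _ = expansionTerm α d 0 + ∑' i, expansionTerm α d (i + 1) :=
        (summable_expansionTerm hα hd).tsum_eq_zero_add
    _ = _ := by
        simp_rw [hterm, tsum_mul_left]
        congr 1
        simp [expansionTerm]

lemma alphaExpansion_sub_of_agree {α : ℝ} (hα : 1 < α) (n : ℕ) :
    ∀ {d e : ℕ → ℕ}, (∀ i, 1 ≤ d i) → (∀ i, 1 ≤ e i) → (∀ j < n, d j = e j) →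
      alphaExpansion α d - alphaExpansion α e =
        (∏ j ∈ Finset.range n, branchRatio α (d j)) *
          (alphaExpansion α (fun i => d (i + n)) - alphaExpansion α (fun i => e (i + n))) := by
  induction n with
  | zero => intros; simp
  | succ n ih =>
    intro d e hd he hde
    rw [alphaExpansion_eq_shift hα hd, alphaExpansion_eq_shift hα he, ← hde 0 n.succ_pos,
      Finset.prod_range_succ']
    have := ih (d := fun i => d (i + 1)) (e := fun i => e (i + 1)) (fun i => hd _)
      (fun i => he _) fun j hj => hde _ (by omega)
    simp only [add_assoc] at this
    linear_combination branchRatio α (d 0) * this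

lemma dist_alphaExpansion_le_of_agree {α : ℝ} (hα : 1 < α) {n : ℕ} {d e : ℕ → ℕ}
    (hd : ∀ i, 1 ≤ d i) (he : ∀ i, 1 ≤ e i) (hde : ∀ j < n, d j = e j) :
    dist (alphaExpansion α d) (alphaExpansion α e) ≤
      ∏ j ∈ Finset.range n, branchRatio α (d j) := by
  have hpos : 0 ≤ ∏ j ∈ Finset.range n, branchRatio α (d j) :=
    Finset.prod_nonneg fun j _ => (branchRatio_pos hα _).le
  rw [Real.dist_eq, alphaExpansion_sub_of_agree hα n hd he hde, abs_mul, abs_of_nonneg hpos]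
  refine mul_le_of_le_one_right hpos (abs_le.2 ?_)
  have h1 := alphaExpansion_nonneg hα fun i => d (i + n)
  have h2 := alphaExpansion_nonneg hα fun i => e (i + n)
  have h3 := alphaExpansion_le_one hα fun i => hd (i + n)
  have h4 := alphaExpansion_le_one hα fun i => he (i + n)
  constructor <;> linarith

/-- With bounded digits, expansions whose first digits are ordered are uniformly separated. -/
lemma alphaExpansion_sub_ge_of_head_lt {α : ℝ} (hα : 1 < α) {m : ℕ} {d e : ℕ → ℕ}
    (hd : ∀ i, 1 ≤ d i) (hdm : ∀ i, d i ≤ m) (he : ∀ i, 1 ≤ e i) (hlt : d 0 < e 0) :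
    (α - 1) / α ^ m / α ^ m ≤ alphaExpansion α d - alphaExpansion α e := by
  have hα0 : 0 < α := by linarith
  have hα1 : 0 < α - 1 := by linarith
  have hinv {k : ℕ} (hk : k ≤ m) : (α ^ m)⁻¹ ≤ (α ^ k)⁻¹ := by
    have : α ^ k ≤ α ^ m := pow_le_pow_right₀ hα.le hk
    gcongr
  have htail : (α ^ m)⁻¹ ≤ alphaExpansion α (fun i => d (i + 1)) := by
    rw [alphaExpansion_eq_shift hα fun i => hd (i + 1)]
    have := mul_nonneg (branchRatio_pos hα (d (0 + 1))).le
      (alphaExpansion_nonneg hα fun i => d (i + 1 + 1))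
    linarith [hinv (hdm (0 + 1))]
  have he1 : alphaExpansion α e ≤ (α ^ d 0)⁻¹ := by
    have hpow : α ^ (d 0 + 1) ≤ α ^ e 0 := pow_le_pow_right₀ hα.le hlt
    calc alphaExpansion α e ≤ (α ^ e 0)⁻¹ + branchRatio α (e 0) * 1 := by
          rw [alphaExpansion_eq_shift hα he]
          have := alphaExpansion_le_one hα fun i => he (i + 1)
          have := (branchRatio_pos hα (e 0)).le
          gcongr
      _ = α * (α ^ e 0)⁻¹ := by rw [branchRatio]; ring
      _ ≤ α * (α ^ (d 0 + 1))⁻¹ := by gcongr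
      _ = (α ^ d 0)⁻¹ := by rw [pow_succ]; field_simp
  have hd1 : (α ^ d 0)⁻¹ + (α - 1) / α ^ m / α ^ m ≤ alphaExpansion α d := by
    rw [alphaExpansion_eq_shift hα hd, branchRatio, div_eq_mul_inv, div_eq_mul_inv (α - 1),
      div_eq_mul_inv]
    have := hinv (hdm 0)
    gcongr
  linarith

lemma dist_alphaExpansion_ge_of_head_ne {α : ℝ} (hα : 1 < α) {m : ℕ} {d e : ℕ → ℕ}
    (hd : ∀ i, 1 ≤ d i) (hdm : ∀ i, d i ≤ m) (he : ∀ i, 1 ≤ e i) (hem : ∀ i, e i ≤ m)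
    (hne : d 0 ≠ e 0) :
    (α - 1) / α ^ m / α ^ m ≤ dist (alphaExpansion α d) (alphaExpansion α e) := by
  rcases hne.lt_or_gt with hlt | hlt
  · exact (alphaExpansion_sub_ge_of_head_lt hα hd hdm he hlt).trans (le_abs_self _)
  · rw [dist_comm]
    exact (alphaExpansion_sub_ge_of_head_lt hα he hem hd hlt).trans (le_abs_self _)

/-! ### Upper bound -/

lemma ENNReal.tsum_pi_prod {β : Type*} (f : β → ℝ≥0∞) (n : ℕ) :
    ∑' w : Fin n → β, ∏ j, f (w j) = (∑' b, f b) ^ n := by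
  induction n with
  | zero => simp
  | succ n ih =>
    rw [← (Fin.consEquiv fun _ => β).tsum_eq, ENNReal.tsum_prod', pow_succ', ← ih,
      ← ENNReal.tsum_mul_right]
    refine tsum_congr fun b => ?_
    rw [← ENNReal.tsum_mul_left]
    exact tsum_congr fun w => by simp [Fin.prod_univ_succ, Fin.consEquiv]

lemma tsum_ofReal_branchRatio_rpow {α : ℝ} (hα : 1 < α) {D : Set ℕ} {h : ℝ} (hh : 0 ≤ h)
    (hMoran : ∑' i : D, branchRatio α i ^ h = 1) :
    ∑' i : D, ENNReal.ofReal (branchRatio α i) ^ h = 1 := by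
  have hsum : Summable fun i : D => branchRatio α i ^ h := by
    by_contra hns
    simp [tsum_eq_zero_of_not_summable hns] at hMoran
  simp_rw [ENNReal.ofReal_rpow_of_nonneg (branchRatio_pos hα _).le hh]
  rw [← ENNReal.ofReal_tsum_of_nonneg
    (fun i => Real.rpow_nonneg (branchRatio_pos hα _).le _) hsum, hMoran, ENNReal.ofReal_one]

lemma hausdorffMeasure_restricted_digit_set_le_one {α : ℝ} (hα : 1 < α) {D : Set ℕ}
    (hDpos : ∀ i ∈ D, 1 ≤ i) {h : ℝ} (hh : 0 ≤ h)
    (hMoran : ∑' i : D, branchRatio α i ^ h = 1) :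
    μH[h] {x : ℝ | ∃ d : ℕ → ℕ, (∀ i, d i ∈ D) ∧ alphaExpansion α d = x} ≤ 1 := by
  let cyl (n : ℕ) (w : Fin n → D) : Set ℝ :=
    {x | ∃ d : ℕ → ℕ, (∀ i, d i ∈ D) ∧ (∀ j : Fin n, d j = w j) ∧ alphaExpansion α d = x}
  have hcyl (n : ℕ) (w : Fin n → D) :
      ediam (cyl n w) ≤ ∏ j, ENNReal.ofReal (branchRatio α (w j)) := by
    refine ediam_le ?_
    rintro _ ⟨d, hd, hdw, rfl⟩ _ ⟨e, he, hew, rfl⟩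
    rw [edist_dist, ← ENNReal.ofReal_prod_of_nonneg fun j _ => (branchRatio_pos hα _).le]
    refine ENNReal.ofReal_le_ofReal ?_
    refine (dist_alphaExpansion_le_of_agree hα (n := n) (fun i => hDpos _ (hd i))
      (fun i => hDpos _ (he i)) fun j hj => (hdw ⟨j, hj⟩).trans (hew ⟨j, hj⟩).symm).trans_eq ?_
    rw [← Fin.prod_univ_eq_prod_range fun j => branchRatio α (d j)]
    simp_rw [hdw]
  have hsmall (n : ℕ) (w : Fin n → D) :
      ediam (cyl n w) ≤ ENNReal.ofReal (branchRatio α 1) ^ n := by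
    refine (hcyl n w).trans ?_
    calc ∏ j, ENNReal.ofReal (branchRatio α (w j))
        ≤ ∏ _j : Fin n, ENNReal.ofReal (branchRatio α 1) :=
          Finset.prod_le_prod' fun j _ =>
            ENNReal.ofReal_le_ofReal (branchRatio_le_one hα (hDpos _ (w j).2))
      _ = _ := by simp
  have hlim : Tendsto (fun n : ℕ => ENNReal.ofReal (branchRatio α 1) ^ n) atTop (𝓝 0) :=
    ENNReal.tendsto_pow_atTop_nhds_zero_of_lt_one
      (ENNReal.ofReal_lt_one.2 (branchRatio_one_lt_one hα))
  refine (Measure.hausdorffMeasure_le_liminf_tsum h _ _ hlim cyl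
    (.of_forall hsmall) (.of_forall fun n => ?_)).trans ?_
  · rintro x ⟨d, hd, rfl⟩
    exact Set.mem_iUnion.2 ⟨fun j => ⟨d j, hd j⟩, d, hd, fun _ => rfl, rfl⟩
  · have hle (n : ℕ) : ∑' w, ediam (cyl n w) ^ h ≤ 1 := by
      calc ∑' w, ediam (cyl n w) ^ h
          ≤ ∑' w : Fin n → D, ∏ j, ENNReal.ofReal (branchRatio α (w j)) ^ h := by
            refine ENNReal.tsum_le_tsum fun w => ?_
            rw [ENNReal.prod_rpow_of_nonneg hh]
            exact ENNReal.rpow_le_rpow (hcyl n w) hh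
        _ = 1 := by
            rw [ENNReal.tsum_pi_prod fun i : D => ENNReal.ofReal (branchRatio α i) ^ h,
              tsum_ofReal_branchRatio_rpow hα hh hMoran, one_pow]
    exact (liminf_le_liminf (.of_forall hle)).trans_eq (by simp)

/-! ### Lower bound -/

/-- **Mass distribution principle** for the image of a measure. -/
lemma hausdorffMeasure_range_ne_zero {Ω : Type*} [MeasurableSpace Ω] {ν : Measure Ω}
    (hν : ν ≠ 0) {g : Ω → ℝ} (hg : Measurable g) {s : ℝ} {C : ℝ≥0∞} (hC : C ≠ ∞)
    (hbound : ∀ U : Set ℝ, ν (g ⁻¹' U) ≤ C * ediam U ^ s) :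
    μH[s] (Set.range g) ≠ 0 := by
  intro hzero
  have hC1 : C + 1 ≠ ∞ := by finiteness
  have hle : (C + 1)⁻¹ • ν.map g ≤ μH[s] := by
    refine Measure.le_hausdorffMeasure s _ 1 one_pos fun U _ => ?_
    rw [Measure.smul_apply, smul_eq_mul, ← ENNReal.div_eq_inv_mul]
    refine ENNReal.div_le_of_le_mul' ?_
    calc ν.map g U ≤ ν.map g (closure U) := measure_mono subset_closure
      _ = ν (g ⁻¹' closure U) := Measure.map_apply hg isClosed_closure.measurableSet
      _ ≤ C * ediam (closure U) ^ s := hbound _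
      _ ≤ (C + 1) * ediam U ^ s := by
          rw [ediam_closure]
          gcongr
          exact le_self_add
  have h0 : (C + 1)⁻¹ * ν.map g (Set.range g) ≤ 0 := by
    simpa [hzero] using hle (Set.range g)
  have h1 : ν.map g (Set.range g) = 0 := by
    simpa [hC1] using h0
  have h2 : ν Set.univ ≤ 0 := by
    simpa [h1] using Measure.le_map_apply (μ := ν) hg.aemeasurable (Set.range g)
  exact hν (Measure.measure_univ_eq_zero.1 (le_antisymm h2 bot_le))

lemma measurable_alphaExpansion {α : ℝ} (hα : 1 < α) {F : Finset ℕ} (hF : ∀ i ∈ F, 1 ≤ i) :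
    Measurable fun d : ℕ → F => alphaExpansion α fun i => d i := by
  have hcoord (i : ℕ) : Measurable fun d : ℕ → F => (d i : ℕ) := by fun_prop
  have hterm (i : ℕ) : Measurable fun d : ℕ → F => expansionTerm α (fun j => d j) i := by
    have hsum : Measurable fun d : ℕ → F => ∑ j ∈ Finset.range (i + 1), (d j : ℕ) :=
      Finset.measurable_fun_sum _ fun j _ => hcoord j
    exact (Measurable.of_discrete
      (f := fun k : ℕ => (α - 1) ^ i * α ^ (-(k : ℤ)))).comp hsum
  refine measurable_of_tendsto_metrizable
    (f := fun n (d : ℕ → F) => ∑ i ∈ Finset.range n, expansionTerm α (fun j => d j) i)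
    (fun n => Finset.measurable_fun_sum _ fun i _ => hterm i) (tendsto_pi_nhds.2 fun d => ?_)
  exact (summable_expansionTerm hα fun i => hF _ (d i).2).hasSum.tendsto_sum_nat

/-- The set of sequences sharing with `a` its first `n` terms. -/
def initialCylinder {β : Type*} (a : ℕ → β) (n : ℕ) : Set (ℕ → β) := {d | ∀ j < n, d j = a j}

/-- A product measure giving every cylinder a mass at most the `s`-th power of its ratio. -/
lemma exists_measure_initialCylinder_le {α : ℝ} (hα : 1 < α) {F : Finset ℕ} {s : ℝ}
    (hs : 0 ≤ s) (hF1 : 1 ≤ ∑ i ∈ F, branchRatio α i ^ s) :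
    ∃ ν : Measure (ℕ → F), ν ≠ 0 ∧ ∀ a n, ν (initialCylinder a n) ≤
      ENNReal.ofReal (∏ j ∈ Finset.range n, branchRatio α (a j)) ^ s := by
  set W : ℝ≥0∞ := ∑ i : F, ENNReal.ofReal (branchRatio α i) ^ s with hW
  have hW1 : 1 ≤ W := by
    rw [hW]
    simp_rw [ENNReal.ofReal_rpow_of_nonneg (branchRatio_pos hα _).le hs]
    rw [← ENNReal.ofReal_sum_of_nonneg fun i _ => Real.rpow_nonneg (branchRatio_pos hα _).le _,
      Finset.sum_coe_sort F fun i => branchRatio α i ^ s]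
    exact ENNReal.one_le_ofReal.2 hF1
  have hWtop : W ≠ ∞ := ENNReal.sum_ne_top.2 fun i _ =>
    ENNReal.rpow_ne_top_of_nonneg hs ENNReal.ofReal_ne_top
  let P : PMF F := PMF.ofFintype (fun i => ENNReal.ofReal (branchRatio α i) ^ s * W⁻¹) (by
    rw [← Finset.sum_mul]
    exact ENNReal.mul_inv_cancel (one_pos.trans_le hW1).ne' hWtop)
  have hP (i : F) : P.toMeasure {i} ≤ ENNReal.ofReal (branchRatio α i) ^ s := by
    rw [P.toMeasure_apply_singleton i (measurableSet_singleton i)]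
    exact mul_le_of_le_one_right' (ENNReal.inv_le_one.2 hW1)
  refine ⟨Measure.infinitePi fun _ => P.toMeasure, IsProbabilityMeasure.ne_zero _, fun a n => ?_⟩
  have hcyl : initialCylinder a n = Set.pi (Finset.range n : Set ℕ) fun j => {a j} := by
    ext d
    simp [initialCylinder, Set.mem_pi]
  rw [hcyl, Measure.infinitePi_pi _ fun j _ => measurableSet_singleton (a j),
    ENNReal.ofReal_prod_of_nonneg fun j _ => (branchRatio_pos hα _).le,
    ← ENNReal.prod_rpow_of_nonneg hs]
  exact Finset.prod_le_prod' fun j _ => hP (a j)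

/-- A measure dominated on cylinders by powers of the ratios is Hölder regular for the coding. -/
lemma measure_preimage_alphaExpansion_le {α : ℝ} (hα : 1 < α) {F : Finset ℕ}
    (hF : ∀ i ∈ F, 1 ≤ i) {m : ℕ} (hm : ∀ i ∈ F, i ≤ m) {s : ℝ} (hs : 0 < s)
    {ν : Measure (ℕ → F)} (hν : ∀ a n, ν (initialCylinder a n) ≤
      ENNReal.ofReal (∏ j ∈ Finset.range n, branchRatio α (a j)) ^ s) (U : Set ℝ) :
    ν ((fun d : ℕ → F => alphaExpansion α fun i => d i) ⁻¹' U) ≤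
      (ENNReal.ofReal ((α - 1) / α ^ m / α ^ m))⁻¹ ^ s * ediam U ^ s := by
  set g : (ℕ → F) → ℝ := fun d => alphaExpansion α fun i => d i with hg
  set c : ℝ := (α - 1) / α ^ m / α ^ m with hc
  have hc0 : 0 < c := by
    have : 0 < α - 1 := by linarith
    positivity
  obtain hempty | ⟨a, ha⟩ := (g ⁻¹' U).eq_empty_or_nonempty
  · simp [hempty]
  by_cases hall : ∀ n, g ⁻¹' U ⊆ initialCylinder a n
  · have hlim : Tendsto (fun n : ℕ => (ENNReal.ofReal (branchRatio α 1) ^ s) ^ n) atTop (𝓝 0) :=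
      ENNReal.tendsto_pow_atTop_nhds_zero_of_lt_one (ENNReal.rpow_lt_one
        (ENNReal.ofReal_lt_one.2 (branchRatio_one_lt_one hα)) hs)
    refine (ge_of_tendsto' hlim fun n => ?_).trans bot_le
    refine (measure_mono (hall n)).trans ((hν a n).trans ?_)
    rw [← ENNReal.rpow_natCast, ← ENNReal.rpow_mul, mul_comm, ENNReal.rpow_mul,
      ENNReal.rpow_natCast, ← ENNReal.ofReal_pow (branchRatio_pos hα 1).le]
    gcongr
    exact prod_branchRatio_le hα (fun i => hF _ (a i).2) n
  · push Not at hall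
    obtain ⟨n, hn, hn'⟩ : ∃ n, g ⁻¹' U ⊆ initialCylinder a n ∧
        ¬ g ⁻¹' U ⊆ initialCylinder a (n + 1) := by
      by_contra! hcon
      obtain ⟨k, hk⟩ := hall
      exact hk (Nat.rec (fun d _ j hj => absurd hj (Nat.not_lt_zero j)) hcon k)
    obtain ⟨b, hb, hbn⟩ := Set.not_subset.1 hn'
    have hab : a n ≠ b n := fun heq => hbn fun j hj => by
      rcases Nat.lt_succ_iff_lt_or_eq.1 hj with hj | rfl
      · exact hn hb j hj
      · exact heq.symm
    set R : ℝ := ∏ j ∈ Finset.range n, branchRatio α (a j) with hR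
    have hR0 : 0 ≤ R := Finset.prod_nonneg fun j _ => (branchRatio_pos hα _).le
    have hdist : R * c ≤ dist (g a) (g b) := by
      have hsub := alphaExpansion_sub_of_agree hα n (d := fun i => a i) (e := fun i => b i)
        (fun i => hF _ (a i).2) (fun i => hF _ (b i).2) fun j hj => by rw [hn hb j hj]
      rw [Real.dist_eq, hg, hsub, abs_mul, abs_of_nonneg hR0]
      refine mul_le_mul_of_nonneg_left ?_ hR0
      exact dist_alphaExpansion_ge_of_head_ne hα (d := fun i => a (i + n))
        (e := fun i => b (i + n)) (fun i => hF _ (a _).2) (fun i => hm _ (a _).2)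
        (fun i => hF _ (b _).2) (fun i => hm _ (b _).2)
        (by simpa only [zero_add, ne_eq, Subtype.coe_inj] using hab)
    have hRU : ENNReal.ofReal R ≤ (ENNReal.ofReal c)⁻¹ * ediam U := by
      rw [← ENNReal.div_eq_inv_mul, ENNReal.le_div_iff_mul_le (by simp [hc0]) (by simp),
        ← ENNReal.ofReal_mul hR0]
      calc ENNReal.ofReal (R * c) ≤ edist (g a) (g b) := by
            rw [edist_dist]
            exact ENNReal.ofReal_le_ofReal hdist
        _ ≤ ediam U := edist_le_ediam_of_mem ha hb
    rw [← ENNReal.mul_rpow_of_nonneg _ _ hs.le]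
    exact (measure_mono hn).trans ((hν a n).trans (ENNReal.rpow_le_rpow hRU hs.le))

/-- Below the Moran exponent, finitely many digits already carry total weight at least one. -/
lemma exists_finset_one_le_sum_branchRatio_rpow {α : ℝ} (hα : 1 < α) {D : Set ℕ}
    (hDpos : ∀ i ∈ D, 1 ≤ i) {h s : ℝ} (hsh : s < h)
    (hMoran : ∑' i : D, branchRatio α i ^ h = 1) :
    ∃ F : Finset ℕ, ↑F ⊆ D ∧ 1 ≤ ∑ i ∈ F, branchRatio α i ^ s := by
  have hsum : Summable fun i : D => branchRatio α i ^ h := by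
    by_contra hns
    simp [tsum_eq_zero_of_not_summable hns] at hMoran
  set q : ℝ := branchRatio α 1 ^ (h - s) with hq
  have hq0 : 0 < q := Real.rpow_pos_of_pos (branchRatio_pos hα 1) _
  have hq1 : q < 1 :=
    Real.rpow_lt_one (branchRatio_pos hα 1).le (branchRatio_one_lt_one hα) (by linarith)
  have hsum1 : HasSum (fun i : D => branchRatio α i ^ h) 1 := hMoran ▸ hsum.hasSum
  obtain ⟨G, hG⟩ := (hsum1.eventually (lt_mem_nhds hq1)).exists
  have hle (i : D) : branchRatio α i ^ h ≤ q * branchRatio α i ^ s := by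
    have hi := branchRatio_pos hα i
    calc branchRatio α i ^ h = branchRatio α i ^ (h - s) * branchRatio α i ^ s := by
          rw [← Real.rpow_add hi, sub_add_cancel]
      _ ≤ q * branchRatio α i ^ s := by
          gcongr
          exact Real.rpow_le_rpow hi.le (branchRatio_le_one hα (hDpos _ i.2)) (by linarith)
  refine ⟨G.map (Function.Embedding.subtype _), by simp, ?_⟩
  rw [Finset.sum_map]
  have hlt : q * 1 < q * ∑ i ∈ G, branchRatio α i ^ s := by
    rw [mul_one, Finset.mul_sum]
    exact hG.trans_le (Finset.sum_le_sum fun i _ => hle i)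
  exact (lt_of_mul_lt_mul_left hlt hq0.le).le

lemma le_dimH_restricted_digit_set {α : ℝ} (hα : 1 < α) {D : Set ℕ}
    (hDpos : ∀ i ∈ D, 1 ≤ i) {h : ℝ} (hMoran : ∑' i : D, branchRatio α i ^ h = 1) :
    ENNReal.ofReal h ≤
      dimH {x : ℝ | ∃ d : ℕ → ℕ, (∀ i, d i ∈ D) ∧ alphaExpansion α d = x} := by
  refine ENNReal.le_of_forall_nnreal_lt fun s hs => ?_
  rcases eq_or_ne s 0 with rfl | hs0
  · simp
  have hs0 : (0 : ℝ) < s := NNReal.coe_pos.2 (pos_iff_ne_zero.2 hs0)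
  have hsh : (s : ℝ) < h := by
    rw [← ENNReal.ofReal_coe_nnreal] at hs
    exact (ENNReal.ofReal_lt_ofReal_iff_of_nonneg hs0.le).1 hs
  obtain ⟨F, hFD, hF1⟩ := exists_finset_one_le_sum_branchRatio_rpow hα hDpos hsh hMoran
  have hF (i) (hi : i ∈ F) : 1 ≤ i := hDpos i (hFD hi)
  obtain ⟨ν, hν0, hν⟩ := exists_measure_initialCylinder_le hα hs0.le hF1
  have hne := hausdorffMeasure_range_ne_zero hν0 (measurable_alphaExpansion hα hF)
    (ENNReal.rpow_ne_top_of_nonneg hs0.le (ENNReal.inv_ne_top.2 (by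
      have : 0 < α - 1 := by linarith
      simp only [ne_eq, ENNReal.ofReal_eq_zero, not_le]
      positivity)))
    (measure_preimage_alphaExpansion_le hα hF
      (fun i hi => Finset.le_sup (f := id) hi) hs0 hν)
  refine (le_dimH_of_hausdorffMeasure_ne_zero hne).trans (dimH_mono ?_)
  rintro _ ⟨d, rfl⟩
  exact ⟨fun i => d i, fun i => hFD (d i).2, rfl⟩

theorem dimH_restricted_digit_set (α : ℝ) (hα : 1 < α)
    (D : Set ℕ) (hDpos : ∀ i ∈ D, 1 ≤ i) (hDne : D.Nonempty)
    (hDproper : D ≠ {n : ℕ | 1 ≤ n})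
    (h : ℝ) (hh : 0 ≤ h)
    (hMoran : ∑' i : D, ((α - 1) / α ^ (i : ℕ)) ^ h = 1) :
    dimH {x : ℝ | ∃ d : ℕ → ℕ, (∀ i, d i ∈ D) ∧ alphaExpansion α d = x} =
      ENNReal.ofReal h := by
  refine le_antisymm ?_ (le_dimH_restricted_digit_set hα hDpos hMoran)
  refine dimH_le_of_hausdorffMeasure_ne_top ?_
  rw [Real.coe_toNNReal h hh]
  exact ((hausdorffMeasure_restricted_digit_set_le_one hα hDpos hh hMoran).trans_lt
    ENNReal.one_lt_top).ne
end

section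
/- Let α > 1 be a real number, let n be a positive integer, and let 𝔭 = (p_1,…,p_n) with each p_d ∈ [0,1) and ∑_{d=1}^n p_d = 1 be a probability distribution on {1,…,n}. Then the set 𝔉_α(𝔭) of x ∈ (0,1] whose α-expansion has digit frequency 𝔣_{d,α}(x) = p_d for each d = 1,…,n has Hausdorff dimension H(𝔭)/(log(α)·E(𝔭) − log(α−1)), where H(𝔭) = −∑_{d=1}^n p_d log p_d is the entropy and E(𝔭) = ∑_{d=1}^n d·p_d is the expected value (with the convention 0·log 0 = 0). -/
open MeasureTheory Filter

namespace AlphaExpansion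

/-- The contraction ratio of the inverse branch with digit `d`. -/
noncomputable def ratio (α : ℝ) (d : ℕ) : ℝ := (α - 1) / α ^ d

/-- The inverse branch with digit `d`: prepends `d` to an expansion. -/
noncomputable def branch (α : ℝ) (d : ℕ) (x : ℝ) : ℝ := (1 + (α - 1) * x) / α ^ d

/-- The set of numbers in `(0, 1]` whose expansion starts with the word `w`. -/
def cylinder (α : ℝ) : List ℕ → Set ℝ
  | [] => Set.Ioc 0 1
  | d :: w => branch α d '' cylinder α w

/-- The length of the interval `cylinder α w`. -/
noncomputable def cylinderLength (α : ℝ) (w : List ℕ) : ℝ := (w.map (ratio α)).prod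

variable {α : ℝ}

lemma ratio_pos (hα : 1 < α) (d : ℕ) : 0 < ratio α d := by
  have : 0 < α - 1 := by linarith
  unfold ratio; positivity

lemma ratio_anti (hα : 1 < α) {d e : ℕ} (h : d ≤ e) : ratio α e ≤ ratio α d := by
  unfold ratio
  have : 0 ≤ α - 1 := by linarith
  have := pow_le_pow_right₀ hα.le h
  gcongr

lemma ratio_one_lt (hα : 1 < α) : ratio α 1 < 1 := by
  unfold ratio
  rw [pow_one, div_lt_one (by linarith)]
  linarith

lemma ratio_lt_one (hα : 1 < α) {d : ℕ} (hd : 1 ≤ d) : ratio α d < 1 :=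
  (ratio_anti hα hd).trans_lt (ratio_one_lt hα)

lemma log_ratio (hα : 1 < α) (d : ℕ) :
    Real.log (ratio α d) = Real.log (α - 1) - d * Real.log α := by
  unfold ratio
  rw [Real.log_div (by linarith) (by positivity), Real.log_pow]

lemma cylinderLength_pos (hα : 1 < α) (w : List ℕ) : 0 < cylinderLength α w := by
  unfold cylinderLength
  refine List.prod_pos ?_
  simp only [List.mem_map]
  rintro _ ⟨d, -, rfl⟩
  exact ratio_pos hα d

lemma cylinderLength_append (w v : List ℕ) :
    cylinderLength α (w ++ v) = cylinderLength α w * cylinderLength α v := by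
  simp [cylinderLength]

lemma cylinderLength_le_pow (hα : 1 < α) {w : List ℕ} (hw : ∀ d ∈ w, 1 ≤ d) :
    cylinderLength α w ≤ ratio α 1 ^ w.length := by
  induction w with
  | nil => simp [cylinderLength]
  | cons d w ih =>
    simp only [cylinderLength, List.map_cons, List.prod_cons, List.length_cons, pow_succ'] at ih ⊢
    exact mul_le_mul (ratio_anti hα (hw d (by simp)))
      (ih fun e he => hw e (List.mem_cons_of_mem _ he))
      (cylinderLength_pos hα w).le (ratio_pos hα 1).le

lemma pow_le_cylinderLength (hα : 1 < α) {N : ℕ} {w : List ℕ} (hw : ∀ d ∈ w, d ≤ N) :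
    ratio α N ^ w.length ≤ cylinderLength α w := by
  induction w with
  | nil => simp [cylinderLength]
  | cons d w ih =>
    simp only [cylinderLength, List.map_cons, List.prod_cons, List.length_cons, pow_succ'] at ih ⊢
    exact mul_le_mul (ratio_anti hα (hw d (by simp)))
      (ih fun e he => hw e (List.mem_cons_of_mem _ he))
      (pow_nonneg (ratio_pos hα N).le _) (ratio_pos hα d).le

lemma cylinderLength_ofFn {k : ℕ} (w : Fin k → ℕ) :
    cylinderLength α (List.ofFn w) = ∏ i, ratio α (w i) := by
  simp [cylinderLength, List.map_ofFn, List.prod_ofFn]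

lemma branch_injective (hα : 1 < α) (d : ℕ) : Function.Injective (branch α d) := by
  intro x y h
  unfold branch at h
  have h1 : α ^ d ≠ 0 := by positivity
  have h2 : α - 1 ≠ 0 := by linarith
  rw [div_left_inj' h1] at h
  exact mul_left_cancel₀ h2 (add_left_cancel h)

lemma branch_image_Ioc (hα : 1 < α) (d : ℕ) (a b : ℝ) :
    branch α d '' Set.Ioc a b = Set.Ioc (branch α d a) (branch α d b) := by
  have h0 : 0 < α - 1 := by linarith
  have h1 : 0 < α ^ d := by positivity
  ext y
  simp only [Set.mem_image, Set.mem_Ioc, branch]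
  constructor
  · rintro ⟨x, ⟨hx, hx'⟩, rfl⟩
    constructor <;> gcongr
  · rintro ⟨h, h'⟩
    rw [div_lt_iff₀ h1] at h
    rw [le_div_iff₀ h1] at h'
    refine ⟨(y * α ^ d - 1) / (α - 1), ⟨?_, ?_⟩, ?_⟩
    · rw [lt_div_iff₀ h0]; linarith
    · rw [div_le_iff₀ h0]; linarith
    · field_simp; ring

lemma cylinder_eq_Ioc (hα : 1 < α) (w : List ℕ) :
    ∃ a, cylinder α w = Set.Ioc a (a + cylinderLength α w) := by
  induction w with
  | nil => exact ⟨0, by simp [cylinder, cylinderLength]⟩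
  | cons d w ih =>
    obtain ⟨a, ha⟩ := ih
    refine ⟨branch α d a, ?_⟩
    rw [cylinder, ha, branch_image_Ioc hα]
    congr 1
    simp only [branch, cylinderLength, ratio, List.map_cons, List.prod_cons]
    ring

lemma ediam_cylinder (hα : 1 < α) (w : List ℕ) :
    Metric.ediam (cylinder α w) = ENNReal.ofReal (cylinderLength α w) := by
  obtain ⟨a, ha⟩ := cylinder_eq_Ioc hα w
  rw [ha, Real.ediam_Ioc, add_sub_cancel_left]

lemma volume_cylinder (hα : 1 < α) (w : List ℕ) :
    volume (cylinder α w) = ENNReal.ofReal (cylinderLength α w) := by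
  obtain ⟨a, ha⟩ := cylinder_eq_Ioc hα w
  rw [ha, Real.volume_Ioc, add_sub_cancel_left]

lemma measurableSet_cylinder (hα : 1 < α) (w : List ℕ) : MeasurableSet (cylinder α w) := by
  obtain ⟨a, ha⟩ := cylinder_eq_Ioc hα w
  rw [ha]
  exact measurableSet_Ioc

lemma cylinder_subset (hα : 1 < α) {w : List ℕ} (hw : ∀ d ∈ w, 1 ≤ d) :
    cylinder α w ⊆ Set.Ioc 0 1 := by
  induction w with
  | nil => exact subset_rfl
  | cons d w ih =>
    rintro _ ⟨x, hx, rfl⟩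
    obtain ⟨h0, h1⟩ := ih (fun e he => hw e (List.mem_cons_of_mem _ he)) hx
    have h2 : 0 < α - 1 := by linarith
    refine ⟨by unfold branch; positivity, ?_⟩
    unfold branch
    rw [div_le_one (by positivity)]
    have := pow_le_pow_right₀ hα.le (hw d (by simp))
    nlinarith

lemma branch_lt_branch (hα : 1 < α) {d e : ℕ} (h : d < e) {x y : ℝ} (hx : 0 < x) (hy : y ≤ 1) :
    branch α e y < branch α d x := by
  have h2 : 0 < α - 1 := by linarith
  have h3 : (1 + (α - 1) * y) / α ^ e ≤ 1 / α ^ d := by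
    rw [div_le_div_iff₀ (by positivity) (by positivity)]
    have := pow_le_pow_right₀ hα.le (Nat.succ_le_of_lt h)
    rw [pow_succ] at this
    have h4 : 0 < α ^ d := by positivity
    nlinarith [mul_le_mul_of_nonneg_left hy h2.le]
  refine h3.trans_lt ?_
  unfold branch
  gcongr
  have := mul_pos h2 hx
  linarith

lemma prefix_or_prefix_of_mem_cylinder (hα : 1 < α) {w v : List ℕ} (hw : ∀ d ∈ w, 1 ≤ d)
    (hv : ∀ d ∈ v, 1 ≤ d) {x : ℝ} (hxw : x ∈ cylinder α w) (hxv : x ∈ cylinder α v) :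
    w <+: v ∨ v <+: w := by
  induction w generalizing v x with
  | nil => exact Or.inl List.nil_prefix
  | cons d w ih =>
    cases v with
    | nil => exact Or.inr List.nil_prefix
    | cons e v =>
      have hw' : ∀ d ∈ w, 1 ≤ d := fun e he => hw e (List.mem_cons_of_mem _ he)
      have hv' : ∀ d ∈ v, 1 ≤ d := fun e he => hv e (List.mem_cons_of_mem _ he)
      obtain ⟨y, hy, rfl⟩ := hxw
      obtain ⟨z, hz, hzy⟩ := hxv
      have hy' := cylinder_subset hα hw' hy
      have hz' := cylinder_subset hα hv' hz
      rcases lt_trichotomy d e with h | rfl | h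
      · exact absurd hzy (branch_lt_branch hα h hy'.1 hz'.2).ne
      · obtain rfl := branch_injective hα _ hzy
        simpa [List.cons_prefix_cons] using ih hw' hv' hy hz
      · exact absurd hzy (branch_lt_branch hα h hz'.1 hy'.2).ne'

/-- The first `k` digits of a digit sequence. -/
def word (dig : ℕ → ℕ) (k : ℕ) : List ℕ := List.ofFn fun i : Fin k => dig i

lemma word_succ (dig : ℕ → ℕ) (k : ℕ) : word dig (k + 1) = word dig k ++ [dig k] := by
  simp only [word, List.ofFn_succ', List.concat_eq_append, Fin.val_castSucc, Fin.val_last]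

lemma word_succ_cons (dig : ℕ → ℕ) (k : ℕ) :
    word dig (k + 1) = dig 0 :: word (fun i => dig (i + 1)) k := by
  simp [word, List.ofFn_succ]

lemma length_word (dig : ℕ → ℕ) (k : ℕ) : (word dig k).length = k := by simp [word]

lemma forall_mem_word {dig : ℕ → ℕ} {Q : ℕ → Prop} (h : ∀ i, Q (dig i)) (k : ℕ) :
    ∀ d ∈ word dig k, Q d := by
  intro d hd
  obtain ⟨i, rfl⟩ := by simpa [word, List.mem_ofFn] using hd
  exact h _

lemma cylinderLength_word (dig : ℕ → ℕ) (k : ℕ) :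
    cylinderLength α (word dig k) = ∏ i ∈ Finset.range k, ratio α (dig i) := by
  rw [word, cylinderLength_ofFn, Fin.prod_univ_eq_prod_range (fun i => ratio α (dig i))]

lemma term_le_s13 (hα : 1 < α) {dig : ℕ → ℕ} (hdig : ∀ i, 1 ≤ dig i) (i : ℕ) :
    (α - 1) ^ i * α ^ (-((∑ j ∈ Finset.range (i + 1), dig j : ℕ) : ℤ)) ≤
      α⁻¹ * ratio α 1 ^ i := by
  have h0 : 0 < α - 1 := by linarith
  have h1 : i + 1 ≤ ∑ j ∈ Finset.range (i + 1), dig j := by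
    simpa using Finset.card_nsmul_le_sum (Finset.range (i + 1)) dig 1 fun j _ => hdig j
  have h2 := pow_le_pow_right₀ hα.le h1
  rw [zpow_neg, zpow_natCast]
  calc _ ≤ (α - 1) ^ i * (α ^ (i + 1))⁻¹ := by gcongr
    _ = _ := by rw [ratio, pow_one, div_pow, pow_succ]; field_simp

lemma term_pos_s13 (hα : 1 < α) (dig : ℕ → ℕ) (i : ℕ) :
    0 < (α - 1) ^ i * α ^ (-((∑ j ∈ Finset.range (i + 1), dig j : ℕ) : ℤ)) := by
  have h0 : 0 < α - 1 := by linarith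
  positivity

lemma summable_term_s13 (hα : 1 < α) {dig : ℕ → ℕ} (hdig : ∀ i, 1 ≤ dig i) :
    Summable fun i : ℕ =>
      (α - 1) ^ i * α ^ (-((∑ j ∈ Finset.range (i + 1), dig j : ℕ) : ℤ)) :=
  Summable.of_nonneg_of_le (fun i => (term_pos_s13 hα dig i).le) (term_le_s13 hα hdig)
    ((summable_geometric_of_lt_one (ratio_pos hα 1).le (ratio_one_lt hα)).mul_left _)

lemma alphaExpansion_mem (hα : 1 < α) {dig : ℕ → ℕ} (hdig : ∀ i, 1 ≤ dig i) :
    alphaExpansion α dig ∈ Set.Ioc (0 : ℝ) 1 := by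
  refine ⟨(summable_term_s13 hα hdig).tsum_pos (fun i => (term_pos_s13 hα dig i).le) 0
    (term_pos_s13 hα dig 0), ?_⟩
  have hg := summable_geometric_of_lt_one (ratio_pos hα 1).le (ratio_one_lt hα)
  refine ((summable_term_s13 hα hdig).tsum_le_tsum (term_le_s13 hα hdig) (hg.mul_left _)).trans ?_
  rw [tsum_mul_left, tsum_geometric_of_lt_one (ratio_pos hα 1).le (ratio_one_lt hα)]
  have : α ≠ 0 := by positivity
  unfold ratio
  rw [pow_one, one_sub_div this]
  simp [this]

lemma alphaExpansion_eq_branch (hα : 1 < α) {dig : ℕ → ℕ} (hdig : ∀ i, 1 ≤ dig i) :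
    alphaExpansion α dig = branch α (dig 0) (alphaExpansion α fun i => dig (i + 1)) := by
  have h0 : α ≠ 0 := by positivity
  unfold alphaExpansion branch
  rw [(summable_term_s13 hα hdig).tsum_eq_zero_add, add_div, mul_div_assoc, ← tsum_div_const,
    ← tsum_mul_left]
  congr 1
  · simp
  · refine tsum_congr fun i => ?_
    rw [Finset.sum_range_succ' dig (i + 1), Nat.cast_add, neg_add, zpow_add₀ h0, zpow_neg _ (dig 0),
      zpow_natCast, pow_succ]
    ring

lemma alphaExpansion_mem_cylinder (hα : 1 < α) {dig : ℕ → ℕ} (hdig : ∀ i, 1 ≤ dig i) (k : ℕ) :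
    alphaExpansion α dig ∈ cylinder α (word dig k) := by
  induction k generalizing dig with
  | zero => simpa [word, cylinder] using alphaExpansion_mem hα hdig
  | succ k ih =>
    rw [word_succ_cons, alphaExpansion_eq_branch hα hdig]
    exact Set.mem_image_of_mem _ (ih fun i => hdig (i + 1))

/-- Distinct words at which the cylinder length first drops to `δ` or below
have disjoint cylinders. -/
lemma disjoint_cylinder_of_stopped (hα : 1 < α) {δ : ℝ} {w v : List ℕ} (hw : ∀ d ∈ w, 1 ≤ d)
    (hv : ∀ d ∈ v, 1 ≤ d) (hwδ : cylinderLength α w ≤ δ) (hvδ : cylinderLength α v ≤ δ)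
    (hwδ' : δ < cylinderLength α w.dropLast) (hvδ' : δ < cylinderLength α v.dropLast)
    (hne : w ≠ v) : Disjoint (cylinder α w) (cylinder α v) := by
  have aux : ∀ {w v : List ℕ}, (∀ d ∈ v, 1 ≤ d) → cylinderLength α w ≤ δ →
      δ < cylinderLength α v.dropLast → w ≠ v → ¬ w <+: v := by
    rintro w _ hv hwδ hvδ' hne ⟨t, rfl⟩
    have ht : t ≠ [] := by rintro rfl; simp at hne
    rw [List.dropLast_append_of_ne_nil ht, cylinderLength_append] at hvδ'
    have h1 : cylinderLength α t.dropLast ≤ 1 :=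
      (cylinderLength_le_pow hα fun d hd => hv d (by simp [List.mem_of_mem_dropLast hd])).trans
        (pow_le_one₀ (ratio_pos hα 1).le (ratio_one_lt hα).le)
    nlinarith [cylinderLength_pos hα w]
  rw [Set.disjoint_left]
  intro x hxw hxv
  rcases prefix_or_prefix_of_mem_cylinder hα hw hv hxw hxv with h | h
  · exact aux hv hwδ hvδ' hne h
  · exact aux hw hvδ hwδ' hne.symm h

/-- Each digit `d + 1` with `d : Fin n` has asymptotic frequency `p d` in the sequence `dig`. -/
def HasFrequencies {n : ℕ} (p : Fin n → ℝ) (dig : ℕ → ℕ) : Prop :=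
  ∀ d : Fin n,
    Tendsto
      (fun m : ℕ =>
        (((Finset.range m).filter (fun j => dig j = (d : ℕ) + 1)).card : ℝ) / m)
      atTop (nhds (p d))

variable {n : ℕ} {p : Fin n → ℝ}

lemma HasFrequencies.tendsto_average {dig : ℕ → ℕ} (h : HasFrequencies p dig) (a : Fin n → ℝ) :
    Tendsto (fun k : ℕ =>
      (∑ j ∈ Finset.range k, ∑ e : Fin n, if dig j = (e : ℕ) + 1 then a e else 0) / (k : ℝ))
      atTop (nhds (∑ e, p e * a e)) := by
  refine (tendsto_finsetSum Finset.univ fun e _ => (h e).mul_const (a e)).congr fun k => ?_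
  rw [Finset.sum_comm, Finset.sum_div]
  refine Finset.sum_congr rfl fun e _ => ?_
  rw [← Finset.sum_filter, Finset.sum_const, nsmul_eq_mul]
  ring

/-- The Lyapunov exponent `log α · E(𝔭) − log (α − 1)`. -/
noncomputable def lyapunov (α : ℝ) (p : Fin n → ℝ) : ℝ :=
  Real.log α * (∑ d : Fin n, (((d : ℕ) : ℝ) + 1) * p d) - Real.log (α - 1)

lemma sum_mul_log_ratio (hα : 1 < α) (hpsum : ∑ d, p d = 1) :
    ∑ d : Fin n, p d * Real.log (ratio α (d + 1)) = -lyapunov α p := by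
  simp_rw [log_ratio hα, mul_sub, Finset.sum_sub_distrib, ← Finset.sum_mul, hpsum, lyapunov,
    Finset.mul_sum, Nat.cast_add, Nat.cast_one]
  rw [one_mul, neg_sub]
  congr 1
  exact Finset.sum_congr rfl fun d _ => by ring

lemma lyapunov_pos (hα : 1 < α) (hp : ∀ d, 0 ≤ p d) (hpsum : ∑ d, p d = 1) :
    0 < lyapunov α p := by
  have h1 : Real.log (ratio α 1) < 0 := Real.log_neg (ratio_pos hα 1) (ratio_one_lt hα)
  have h2 : ∑ d : Fin n, p d * Real.log (ratio α (d + 1)) ≤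
      ∑ d : Fin n, p d * Real.log (ratio α 1) :=
    Finset.sum_le_sum fun d _ => mul_le_mul_of_nonneg_left
      (Real.log_le_log (ratio_pos hα _) (ratio_anti hα (by omega))) (hp d)
  rw [sum_mul_log_ratio hα hpsum, ← Finset.sum_mul, hpsum] at h2
  linarith

lemma tsum_prod_le_one {q : ℕ → ENNReal} (hq : ∑' d, q d ≤ 1) (k : ℕ) :
    ∑' w : Fin k → ℕ, ∏ i, q (w i) ≤ 1 := by
  induction k with
  | zero => simp
  | succ k ih =>
    rw [← (Fin.consEquiv fun _ : Fin (k + 1) => ℕ).tsum_eq]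
    simp only [Fin.consEquiv, Equiv.coe_fn_mk, Fin.prod_univ_succ, Fin.cons_zero, Fin.cons_succ]
    rw [ENNReal.tsum_prod (f := fun d (w : Fin k → ℕ) => q d * ∏ i, q (w i))]
    simp_rw [ENNReal.tsum_mul_left, ENNReal.tsum_mul_right]
    exact mul_le_one' hq ih

lemma hausdorffMeasure_le_one (hα : 1 < α) {q : ℕ → ENNReal} (hq : ∑' d, q d ≤ 1) {s : ℝ}
    (hs : 0 < s) (N : ℕ) :
    Measure.hausdorffMeasure s {x : ℝ | ∃ dig : ℕ → ℕ, (∀ i, 1 ≤ dig i) ∧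
      alphaExpansion α dig = x ∧ ∀ k ≥ N,
        ENNReal.ofReal (cylinderLength α (word dig k)) ^ s ≤
          ∏ i ∈ Finset.range k, q (dig i)} ≤ 1 := by
  classical
  let good (k : ℕ) (w : Fin k → ℕ) : Prop := (∀ i, 1 ≤ w i) ∧
    ENNReal.ofReal (cylinderLength α (List.ofFn w)) ^ s ≤ ∏ i, q (w i)
  let t (k : ℕ) (w : Fin k → ℕ) : Set ℝ := if good k w then cylinder α (List.ofFn w) else ∅
  have hr : Tendsto (fun k : ℕ => ENNReal.ofReal (ratio α 1 ^ k)) atTop (nhds 0) := by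
    rw [← ENNReal.ofReal_zero]
    exact ENNReal.tendsto_ofReal
      (tendsto_pow_atTop_nhds_zero_of_lt_one (ratio_pos hα 1).le (ratio_one_lt hα))
  refine (Measure.hausdorffMeasure_le_liminf_tsum s _ _ hr t ?_ ?_).trans ?_
  · refine Eventually.of_forall fun k w => ?_
    by_cases h : good k w
    · simp only [t, if_pos h, ediam_cylinder hα]
      refine ENNReal.ofReal_le_ofReal ?_
      have := cylinderLength_le_pow hα (w := List.ofFn w) (by
        intro d hd
        obtain ⟨i, rfl⟩ := (List.mem_ofFn' _ _).1 hd
        exact h.1 i)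
      simpa using this
    · simp [t, if_neg h]
  · filter_upwards [eventually_ge_atTop N] with k hk
    rintro x ⟨dig, hdig, rfl, h⟩
    refine Set.mem_iUnion.2 ⟨fun i => dig i, ?_⟩
    have hg : good k (fun i => dig i) := by
      refine ⟨fun i => hdig i, ?_⟩
      rw [Fin.prod_univ_eq_prod_range (fun i => q (dig i))]
      exact h k hk
    simp only [t, if_pos hg]
    exact alphaExpansion_mem_cylinder hα hdig k
  · refine liminf_le_of_frequently_le' (Frequently.of_forall fun k => ?_)
    refine (ENNReal.tsum_le_tsum fun w => ?_).trans (tsum_prod_le_one hq k)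
    by_cases h : good k w
    · simpa only [t, if_pos h, ediam_cylinder hα] using h.2
    · simp [t, if_neg h, ENNReal.zero_rpow_of_pos hs]

lemma summable_ratio_rpow (hα : 1 < α) {s : ℝ} (hs : 0 < s) :
    Summable fun d => ratio α d ^ s := by
  have h0 : 0 < α - 1 := by linarith
  have h1 : (α ^ s)⁻¹ < 1 := inv_lt_one_of_one_lt₀ (Real.one_lt_rpow hα hs)
  refine ((summable_geometric_of_lt_one (by positivity) h1).mul_left ((α - 1) ^ s)).congr
    fun d => ?_
  rw [ratio, Real.div_rpow h0.le (by positivity), ← Real.rpow_natCast α d,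
    ← Real.rpow_mul (by positivity),
    mul_comm (d : ℝ), Real.rpow_mul (by positivity), Real.rpow_natCast, inv_pow, div_eq_mul_inv]

/-- Digit weights that are comparable with `p` on the digits of positive probability and with
the `s`-th power of the contraction ratio on all other digits. -/
lemma exists_weights (hα : 1 < α) (hp : ∀ d, 0 ≤ p d) (hpsum : ∑ d, p d = 1) {s η : ℝ}
    (hs : 0 < s) (hη : 0 < η) :
    ∃ (q : ℕ → ℝ) (c : ℝ), 0 < c ∧ ∑' d, ENNReal.ofReal (q d) ≤ 1 ∧
      (∀ d, c * ratio α d ^ s ≤ q d) ∧ ∀ e : Fin n, Real.exp (-η) * p e ≤ q (e + 1) := by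
  have hsum := summable_ratio_rpow hα hs
  have hpos : ∀ d, 0 < ratio α d ^ s := fun d => Real.rpow_pos_of_pos (ratio_pos hα d) s
  have hB := hsum.tsum_pos (fun d => (hpos d).le) 0 (hpos 0)
  set B := ∑' d, ratio α d ^ s
  have hη' : 0 < 1 - Real.exp (-η) := by simpa using hη
  have hc : 0 < (1 - Real.exp (-η)) / B := div_pos hη' hB
  set c := (1 - Real.exp (-η)) / B with hcdef
  have hterm : ∀ d : ℕ, ∀ e : Fin n,
      0 ≤ if d = (e : ℕ) + 1 then Real.exp (-η) * p e else 0 := by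
    intro d e
    split_ifs
    · exact mul_nonneg (Real.exp_pos _).le (hp e)
    · exact le_rfl
  have hsumq : HasSum (fun d : ℕ =>
      (∑ e : Fin n, if d = (e : ℕ) + 1 then Real.exp (-η) * p e else 0)
      + c * ratio α d ^ s) 1 := by
    have h1 : HasSum (fun d : ℕ => ∑ e : Fin n,
        if d = (e : ℕ) + 1 then Real.exp (-η) * p e else 0) (∑ e : Fin n, Real.exp (-η) * p e) :=
      hasSum_sum fun e _ => hasSum_ite_eq _ _
    convert h1.add (hsum.hasSum.mul_left c) using 1
    rw [← Finset.mul_sum, hpsum, hcdef, div_mul_cancel₀ _ hB.ne']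
    ring
  refine ⟨fun d => (∑ e : Fin n, if d = (e : ℕ) + 1 then Real.exp (-η) * p e else 0)
      + c * ratio α d ^ s, c, hc, ?_,
    fun d => le_add_of_nonneg_left (Finset.sum_nonneg fun e _ => hterm d e),
    fun e => ?_⟩
  · rw [← ENNReal.ofReal_tsum_of_nonneg
      (fun d => add_nonneg (Finset.sum_nonneg fun e _ => hterm d e) (mul_pos hc (hpos d)).le)
      hsumq.summable, hsumq.tsum_eq, ENNReal.ofReal_one]
  · refine le_add_of_le_of_nonneg ?_ (mul_pos hc (hpos _)).le
    have := Finset.single_le_sum (fun e' _ => hterm ((e : ℕ) + 1) e') (Finset.mem_univ e)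
    simpa using this

lemma eventually_cylinderLength_rpow_le (hα : 1 < α) (hp : ∀ d, 0 ≤ p d) (hpsum : ∑ d, p d = 1)
    {s η c : ℝ} (hη : η < s * lyapunov α p + ∑ d, p d * Real.log (p d)) (hc : 0 < c) {q : ℕ → ℝ}
    (hq : ∀ d, c * ratio α d ^ s ≤ q d) (hq' : ∀ e : Fin n, Real.exp (-η) * p e ≤ q (e + 1))
    {dig : ℕ → ℕ} (hfreq : HasFrequencies p dig) :
    ∀ᶠ k in atTop, cylinderLength α (word dig k) ^ s ≤ ∏ i ∈ Finset.range k, q (dig i) := by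
  classical
  let a : Fin n → ℝ := fun e => if p e = 0 then 0 else
    Real.log (p e) - s * Real.log (ratio α (e + 1)) - η - Real.log c
  let h : ℕ → ℝ := fun d => (∑ e : Fin n, if d = (e : ℕ) + 1 then a e else 0) + Real.log c
  have hdigit : ∀ d, ratio α d ^ s * Real.exp (h d) ≤ q d := by
    intro d
    have hr := ratio_pos hα d
    by_cases hd : ∃ e : Fin n, d = (e : ℕ) + 1 ∧ p e ≠ 0
    · obtain ⟨e, rfl, hpe⟩ := hd
      have hpe' : 0 < p e := lt_of_le_of_ne (hp e) hpe.symm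
      have : h ((e : ℕ) + 1) = a e + Real.log c := by
        simp only [h]
        rw [Finset.sum_eq_single e]
        · simp
        · intro b _ hb
          rw [if_neg fun hbe => hb (Fin.ext (by omega))]
        · simp
      rw [this]
      simp only [a, if_neg hpe]
      rw [Real.rpow_def_of_pos hr, ← Real.exp_add]
      refine le_trans (le_of_eq ?_) (hq' e)
      conv_rhs => rw [← Real.exp_log hpe', ← Real.exp_add]
      congr 1
      ring
    · have : h d = Real.log c := by
        simp only [h, add_eq_right]
        refine Finset.sum_eq_zero fun e _ => ?_
        split_ifs with hde
        · have : p e = 0 := by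
            by_contra hpe
            exact hd ⟨e, hde, hpe⟩
          simp [a, this]
        · rfl
      rw [this, Real.exp_log hc, mul_comm]
      exact hq d
  have hlim := (hfreq.tendsto_average a).add_const (Real.log c)
  have hval : ∑ e, p e * a e =
      (∑ e, p e * Real.log (p e)) + s * lyapunov α p - η - Real.log c := by
    have : ∀ e, p e * a e = p e * Real.log (p e) - s * (p e * Real.log (ratio α (e + 1)))
        - p e * η - p e * Real.log c := by
      intro e
      by_cases hpe : p e = 0
      · simp [hpe]
      · simp only [a, if_neg hpe]; ring
    simp_rw [this, Finset.sum_sub_distrib, ← Finset.sum_mul, ← Finset.mul_sum,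
      sum_mul_log_ratio hα hpsum, hpsum]
    ring
  rw [hval] at hlim
  filter_upwards [hlim.eventually_const_lt (u := 0) (by linarith), eventually_gt_atTop 0]
    with k hk hk0
  have hk0' : (0 : ℝ) < k := by exact_mod_cast hk0
  have hsum : 0 ≤ ∑ j ∈ Finset.range k, h (dig j) := by
    have : ∑ j ∈ Finset.range k, h (dig j) = k * ((∑ j ∈ Finset.range k,
        ∑ e : Fin n, if dig j = (e : ℕ) + 1 then a e else 0) / (k : ℝ) + Real.log c) := by
      simp only [h, Finset.sum_add_distrib, Finset.sum_const, Finset.card_range, nsmul_eq_mul]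
      field_simp
    rw [this]
    positivity
  calc cylinderLength α (word dig k) ^ s
      = ∏ i ∈ Finset.range k, ratio α (dig i) ^ s := by
        rw [cylinderLength_word, Real.finsetProd_rpow _ _ fun i _ => (ratio_pos hα _).le]
    _ ≤ (∏ i ∈ Finset.range k, ratio α (dig i) ^ s) *
          Real.exp (∑ j ∈ Finset.range k, h (dig j)) :=
        le_mul_of_one_le_right
          (Finset.prod_nonneg fun i _ => (Real.rpow_pos_of_pos (ratio_pos hα _) s).le)
          (Real.one_le_exp hsum)
    _ = ∏ i ∈ Finset.range k, ratio α (dig i) ^ s * Real.exp (h (dig i)) := by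
        rw [Real.exp_sum, Finset.prod_mul_distrib]
    _ ≤ _ := Finset.prod_le_prod
        (fun i _ => (mul_pos (Real.rpow_pos_of_pos (ratio_pos hα _) s) (Real.exp_pos _)).le)
        fun i _ => hdigit (dig i)

lemma dimH_le (hα : 1 < α) (hp : ∀ d, 0 ≤ p d) (hpsum : ∑ d, p d = 1) :
    dimH {x : ℝ | x ∈ Set.Ioc (0 : ℝ) 1 ∧ ∃ dig : ℕ → ℕ, (∀ i, 1 ≤ dig i) ∧
      alphaExpansion α dig = x ∧ HasFrequencies p dig} ≤
      ENNReal.ofReal ((-∑ d, p d * Real.log (p d)) / lyapunov α p) := by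
  refine ENNReal.le_of_forall_nnreal_lt fun s hlt => ?_
  by_contra! hs
  have hs0 : (0 : ℝ) < s := by
    have := pos_of_gt hs
    exact_mod_cast this
  rw [← ENNReal.ofReal_coe_nnreal, ENNReal.ofReal_lt_ofReal_iff hs0,
    div_lt_iff₀ (lyapunov_pos hα hp hpsum)] at hs
  obtain ⟨η, hη0, hη⟩ := exists_between
    (show 0 < s * lyapunov α p + ∑ d, p d * Real.log (p d) by linarith)
  obtain ⟨q, c, hc, hqsum, hq, hq'⟩ := exists_weights hα hp hpsum hs0 hη0
  have hqpos : ∀ d, 0 ≤ q d := fun d =>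
    (mul_pos hc (Real.rpow_pos_of_pos (ratio_pos hα d) _)).le.trans (hq d)
  have hle : dimH {x : ℝ | x ∈ Set.Ioc (0 : ℝ) 1 ∧ ∃ dig : ℕ → ℕ, (∀ i, 1 ≤ dig i) ∧
      alphaExpansion α dig = x ∧ HasFrequencies p dig} ≤ s := by
    refine (dimH_mono (t := ⋃ N : ℕ, {x : ℝ | ∃ dig : ℕ → ℕ, (∀ i, 1 ≤ dig i) ∧
      alphaExpansion α dig = x ∧ ∀ k ≥ N,
        ENNReal.ofReal (cylinderLength α (word dig k)) ^ (s : ℝ) ≤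
          ∏ i ∈ Finset.range k, ENNReal.ofReal (q (dig i))}) ?_).trans ?_
    · rintro x ⟨-, dig, hdig, rfl, hfreq⟩
      obtain ⟨N, hN⟩ := eventually_atTop.1
        (eventually_cylinderLength_rpow_le hα hp hpsum hη hc hq hq' hfreq)
      refine Set.mem_iUnion.2 ⟨N, dig, hdig, rfl, fun k hk => ?_⟩
      rw [ENNReal.ofReal_rpow_of_pos (cylinderLength_pos hα _),
        ← ENNReal.ofReal_prod_of_nonneg fun i _ => hqpos _]
      exact ENNReal.ofReal_le_ofReal (hN k hk)
    · rw [dimH_iUnion]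
      exact iSup_le fun N => dimH_le_of_hausdorffMeasure_ne_top
        ((hausdorffMeasure_le_one hα hqsum hs0 N).trans_lt ENNReal.one_lt_top).ne
  exact absurd hle hlt.not_ge

/-- The digit sequence of a sequence in `Fin n`, where `e : Fin n` stands for the digit `e + 1`. -/
def digits (ω : ℕ → Fin n) (i : ℕ) : ℕ := ω i + 1

lemma one_le_digits (ω : ℕ → Fin n) (i : ℕ) : 1 ≤ digits ω i := Nat.le_add_left 1 _

lemma digits_le (ω : ℕ → Fin n) (i : ℕ) : digits ω i ≤ n := (ω i).isLt

lemma measurable_alphaExpansion_digits :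
    Measurable fun ω : ℕ → Fin n => alphaExpansion α (digits ω) := by
  unfold alphaExpansion digits
  refine Measurable.tsum fun i => Measurable.const_mul ?_ _
  have h : Measurable fun ω : ℕ → Fin n => ∑ j ∈ Finset.range (i + 1), ((ω j : ℕ) + 1) :=
    Finset.measurable_sum _ fun j _ =>
      (measurable_of_finite fun e : Fin n => (e : ℕ) + 1).comp (measurable_pi_apply j)
  exact (measurable_from_nat (f := fun m : ℕ => α ^ (-(m : ℤ)))).comp h

lemma ae_hasFrequencies (hp : ∀ d, 0 ≤ p d) (ν : Measure (Fin n)) [IsProbabilityMeasure ν]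
    (hν : ∀ d, ν {d} = ENNReal.ofReal (p d)) :
    ∀ᵐ ω ∂Measure.infinitePi (fun _ : ℕ => ν), HasFrequencies p (digits ω) := by
  refine ae_all_iff.2 fun d => ?_
  let f : Fin n → ℝ := Set.indicator {d} 1
  have hf : Measurable f := measurable_of_finite f
  have hev (i : ℕ) := measurePreserving_eval_infinitePi (fun _ : ℕ => ν) i
  have hint : ∫ ω : ℕ → Fin n, f (ω 0) ∂Measure.infinitePi (fun _ : ℕ => ν) = p d := by
    have := integral_map (μ := Measure.infinitePi (fun _ : ℕ => ν))
      (hev 0).measurable.aemeasurable (f := f) hf.aestronglyMeasurable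
    rw [(hev 0).map_eq] at this
    refine this.symm.trans ?_
    rw [integral_indicator_one (measurableSet_singleton d), measureReal_def, hν,
      ENNReal.toReal_ofReal (hp d)]
  have hslln := ProbabilityTheory.strong_law_ae_real
    (μ := Measure.infinitePi (fun _ : ℕ => ν)) (fun i ω => f (ω i))
    ((hev 0).integrable_comp_of_integrable (Integrable.of_finite (f := f)))
    (fun i j hij => (ProbabilityTheory.iIndepFun_infinitePi (P := fun _ : ℕ => ν)
      (X := fun _ => f) fun _ => hf).indepFun hij)
    (fun i => ProbabilityTheory.IdentDistrib.comp (u := f)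
      ⟨(hev i).measurable.aemeasurable, (hev 0).measurable.aemeasurable,
        (hev i).map_eq.trans (hev 0).map_eq.symm⟩ hf)
  rw [hint] at hslln
  filter_upwards [hslln] with ω hω
  refine hω.congr fun m => ?_
  congr 1
  simp only [f, digits, Set.indicator_apply, Set.mem_singleton_iff, Pi.one_apply,
    Finset.sum_boole, add_left_inj, Fin.ext_iff]

lemma exists_stopping (hα : 1 < α) (ω : ℕ → Fin n) {δ : ℝ} (hδ : 0 < δ) (hδ1 : δ < 1) :
    ∃ m, cylinderLength α (word (digits ω) (m + 1)) ≤ δ ∧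
      δ < cylinderLength α (word (digits ω) m) := by
  have hex : ∃ k, cylinderLength α (word (digits ω) k) ≤ δ := by
    obtain ⟨k, hk⟩ := exists_pow_lt_of_lt_one hδ (ratio_one_lt hα)
    refine ⟨k, (cylinderLength_le_pow hα (forall_mem_word (one_le_digits ω) k)).trans ?_⟩
    rw [length_word]
    exact hk.le
  classical
  have h0 : Nat.find hex ≠ 0 := by
    intro h
    have := Nat.find_spec hex
    rw [h] at this
    simp [word, cylinderLength] at this
    linarith
  obtain ⟨m, hm⟩ := Nat.exists_eq_succ_of_ne_zero h0
  have hspec := Nat.find_spec hex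
  rw [hm] at hspec
  exact ⟨m, hspec, not_le.1 (Nat.find_min hex (by omega))⟩

lemma infinitePi_word_le (ν : Measure (Fin n)) [IsProbabilityMeasure ν] (ω : ℕ → Fin n) (k : ℕ) :
    Measure.infinitePi (fun _ : ℕ => ν) {ω' | word (digits ω') k = word (digits ω) k} ≤
      ∏ i ∈ Finset.range k, ν {ω i} := by
  rw [← Measure.infinitePi_pi (fun _ : ℕ => ν) (t := fun i => {ω i})
    fun i _ => measurableSet_singleton _]
  refine measure_mono fun ω' h i hi => ?_
  have := congr_fun (List.ofFn_injective h) ⟨i, by simpa using hi⟩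
  simpa [digits, Fin.ext_iff] using this

lemma measure_inter_preimage_le (hα : 1 < α) (ν : Measure (Fin n)) [IsProbabilityMeasure ν]
    {A : Set (ℕ → Fin n)} {N : ℕ} {s : ℝ} (hs : 0 ≤ s)
    (hA : ∀ ω ∈ A, ∀ k ≥ N, ∏ i ∈ Finset.range k, ν {ω i} ≤
      ENNReal.ofReal (cylinderLength α (word (digits ω) k)) ^ s)
    {δ : ℝ} (hδ : 0 < δ) (hδ1 : δ < 1) (hδN : δ < ratio α n ^ N) {U : Set ℝ}
    (hU : Metric.ediam U ≤ ENNReal.ofReal δ) :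
    Measure.infinitePi (fun _ : ℕ => ν) ((fun ω => alphaExpansion α (digits ω)) ⁻¹' U ∩ A) ≤
      ENNReal.ofReal (4 / ratio α n) * ENNReal.ofReal δ ^ s := by
  set V := (fun ω : ℕ → Fin n => alphaExpansion α (digits ω)) ⁻¹' U ∩ A
  rcases V.eq_empty_or_nonempty with hV | ⟨ω₀, hω₀⟩
  · simp [hV]
  have hρ := ratio_pos hα n
  choose K hK hK' using fun ω : ℕ → Fin n => exists_stopping hα ω hδ hδ1
  let W : (ℕ → Fin n) → List ℕ := fun ω => word (digits ω) (K ω + 1)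
  have hWdig : ∀ ω, ∀ d ∈ W ω, 1 ≤ d := fun ω => forall_mem_word (one_le_digits ω) _
  have hNK : ∀ ω, N ≤ K ω + 1 := by
    intro ω
    by_contra! hlt
    have h1 := pow_le_cylinderLength hα (forall_mem_word (Q := (· ≤ n)) (digits_le ω) (K ω + 1))
    rw [length_word] at h1
    have hn : ratio α n < 1 := ratio_lt_one hα ((one_le_digits ω 0).trans (digits_le ω 0))
    have h2 := pow_le_pow_of_le_one hρ.le hn.le hlt.le
    linarith [hK ω]
  have hWlow : ∀ ω, ratio α n * δ ≤ cylinderLength α (W ω) := by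
    intro ω
    simp only [W, word_succ, cylinderLength_append]
    rw [mul_comm]
    refine mul_le_mul (hK' ω).le ?_ hρ.le (cylinderLength_pos hα _).le
    simpa [cylinderLength] using ratio_anti hα (digits_le ω (K ω))
  set E : ENNReal := ENNReal.ofReal δ ^ s * (ENNReal.ofReal (ratio α n * δ))⁻¹ with hE
  have hcyl : ∀ w ∈ W '' V, Measure.infinitePi (fun _ : ℕ => ν)
      {ω' | word (digits ω') w.length = w} ≤ E * volume (cylinder α w) := by
    rintro _ ⟨ω, hω, rfl⟩
    have h1 := infinitePi_word_le ν ω (K ω + 1)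
    have h2 := hA ω hω.2 _ (hNK ω)
    have hlen : (W ω).length = K ω + 1 := length_word _ _
    rw [hlen, volume_cylinder hα]
    refine (h1.trans h2).trans ?_
    calc ENNReal.ofReal (cylinderLength α (W ω)) ^ s
        ≤ ENNReal.ofReal δ ^ s * 1 := by
          rw [mul_one]
          exact ENNReal.rpow_le_rpow (ENNReal.ofReal_le_ofReal (hK ω)) hs
      _ ≤ ENNReal.ofReal δ ^ s * ((ENNReal.ofReal (ratio α n * δ))⁻¹ *
            ENNReal.ofReal (cylinderLength α (W ω))) := by
          gcongr
          rw [← ENNReal.inv_mul_cancel (a := ENNReal.ofReal (ratio α n * δ))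
            (by simpa using mul_pos hρ hδ) ENNReal.ofReal_ne_top]
          gcongr
          exact hWlow ω
      _ = _ := by rw [hE, mul_assoc]
  have hdisj : Pairwise (Function.onFun Disjoint fun w : W '' V => cylinder α (w : List ℕ)) := by
    rintro ⟨_, ω, _, rfl⟩ ⟨_, ω', _, rfl⟩ hne
    have hdrop : ∀ ω, (W ω).dropLast = word (digits ω) (K ω) := fun ω => by
      simp [W, word_succ]
    exact disjoint_cylinder_of_stopped hα (hWdig ω) (hWdig ω') (hK ω) (hK ω')
      (by rw [hdrop]; exact hK' ω) (by rw [hdrop]; exact hK' ω') fun h => hne (Subtype.ext h)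
  have hball : ⋃ w : W '' V, cylinder α (w : List ℕ) ⊆
      Metric.closedBall (alphaExpansion α (digits ω₀)) (2 * δ) := by
    refine Set.iUnion_subset ?_
    rintro ⟨_, ω, hω, rfl⟩ y hy
    have h1 : edist y (alphaExpansion α (digits ω)) ≤ ENNReal.ofReal δ :=
      (Metric.edist_le_ediam_of_mem hy
        (alphaExpansion_mem_cylinder hα (one_le_digits ω) _)).trans
        ((ediam_cylinder hα _).trans_le (ENNReal.ofReal_le_ofReal (hK ω)))
    have h2 : edist (alphaExpansion α (digits ω)) (alphaExpansion α (digits ω₀)) ≤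
        ENNReal.ofReal δ := (Metric.edist_le_ediam_of_mem (s := U) hω.1 hω₀.1).trans hU
    rw [edist_le_ofReal hδ.le] at h1 h2
    rw [Metric.mem_closedBall]
    linarith [dist_triangle y (alphaExpansion α (digits ω)) (alphaExpansion α (digits ω₀))]
  have hcover : V ⊆ ⋃ w ∈ W '' V, {ω' | word (digits ω') w.length = w} := fun ω hω =>
    Set.mem_biUnion (Set.mem_image_of_mem W hω) (by simp [W, length_word])
  calc Measure.infinitePi (fun _ : ℕ => ν) V
      ≤ ∑' w : W '' V, Measure.infinitePi (fun _ : ℕ => ν)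
          {ω' | word (digits ω') (w : List ℕ).length = w} :=
        (measure_mono hcover).trans (measure_biUnion_le _ (Set.to_countable _) _)
    _ ≤ ∑' w : W '' V, E * volume (cylinder α (w : List ℕ)) :=
        ENNReal.tsum_le_tsum fun w => hcyl w w.2
    _ = E * volume (⋃ w : W '' V, cylinder α (w : List ℕ)) := by
        rw [ENNReal.tsum_mul_left, measure_iUnion hdisj fun w => measurableSet_cylinder hα _]
    _ ≤ E * ENNReal.ofReal (2 * (2 * δ)) := by
        rw [← Real.volume_closedBall]
        gcongr
    _ = _ := by
        rw [hE, mul_assoc, ← ENNReal.ofReal_inv_of_pos (mul_pos hρ hδ),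
          ← ENNReal.ofReal_mul (by positivity), mul_comm]
        congr 2
        field_simp
        norm_num

lemma hausdorffMeasure_image_pos (hα : 1 < α) (ν : Measure (Fin n)) [IsProbabilityMeasure ν]
    {A : Set (ℕ → Fin n)} {N : ℕ} {s : ℝ} (hs : 0 < s)
    (hA : ∀ ω ∈ A, ∀ k ≥ N, ∏ i ∈ Finset.range k, ν {ω i} ≤
      ENNReal.ofReal (cylinderLength α (word (digits ω) k)) ^ s)
    (hA0 : Measure.infinitePi (fun _ : ℕ => ν) A ≠ 0) :
    Measure.hausdorffMeasure s ((fun ω => alphaExpansion α (digits ω)) '' A) ≠ 0 := by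
  have hρ := ratio_pos hα n
  set π : (ℕ → Fin n) → ℝ := fun ω => alphaExpansion α (digits ω)
  have hπ : Measurable π := measurable_alphaExpansion_digits
  set P := Measure.infinitePi (fun _ : ℕ => ν)
  set C : ENNReal := ENNReal.ofReal (4 / ratio α n)
  have hC0 : C ≠ 0 := by simpa [C] using hρ
  have hC : C ≠ ⊤ := ENNReal.ofReal_ne_top
  obtain ⟨ε, hε0, hε⟩ := exists_between (lt_min one_pos (pow_pos hρ N))
  have hle : C⁻¹ • (P.restrict A).map π ≤ Measure.hausdorffMeasure s := by
    refine Measure.le_hausdorffMeasure s _ (ENNReal.ofReal (ε / 2)) (by simpa using hε0) ?_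
    intro U hU
    have hkey : ∀ δ : ℝ, 0 < δ → δ ≤ ε → Metric.ediam U ≤ ENNReal.ofReal δ →
        (C⁻¹ • (P.restrict A).map π) U ≤ ENNReal.ofReal δ ^ s := by
      intro δ hδ hδε hUδ
      have h1 : (P.restrict A).map π U ≤ C * ENNReal.ofReal δ ^ s := by
        refine (measure_mono subset_closure).trans ?_
        rw [Measure.map_apply hπ measurableSet_closure,
          Measure.restrict_apply (hπ measurableSet_closure)]
        have := lt_min_iff.1 hε
        exact measure_inter_preimage_le hα ν hs.le hA hδ (by linarith) (by linarith)
          ((Metric.ediam_closure U).trans_le hUδ)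
      rw [Measure.smul_apply, smul_eq_mul]
      calc _ ≤ C⁻¹ * (C * ENNReal.ofReal δ ^ s) := by gcongr
        _ = _ := by rw [← mul_assoc, ENNReal.inv_mul_cancel hC0 hC, one_mul]
    have hUtop : Metric.ediam U ≠ ⊤ := (hU.trans_lt ENNReal.ofReal_lt_top).ne
    have hUε : (Metric.ediam U).toReal ≤ ε / 2 := ENNReal.toReal_le_of_le_ofReal (by positivity) hU
    have hlim : Tendsto (fun t : ℝ => ENNReal.ofReal ((Metric.ediam U).toReal + t) ^ s)
        (nhdsWithin 0 (Set.Ioi 0)) (nhds (Metric.ediam U ^ s)) := by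
      have hc : Continuous fun t : ℝ => ENNReal.ofReal ((Metric.ediam U).toReal + t) ^ s :=
        ENNReal.continuous_rpow_const.comp
          (ENNReal.continuous_ofReal.comp (continuous_const.add continuous_id))
      have := (hc.tendsto 0).mono_left (nhdsWithin_le_nhds (s := Set.Ioi 0))
      simpa [ENNReal.ofReal_toReal hUtop] using this
    refine ge_of_tendsto hlim ?_
    filter_upwards [Ioo_mem_nhdsGT (half_pos hε0)] with t ht
    refine hkey _ (add_pos_of_nonneg_of_pos ENNReal.toReal_nonneg ht.1) (by linarith [ht.2]) ?_
    rw [← ENNReal.ofReal_toReal hUtop]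
    exact ENNReal.ofReal_le_ofReal (by simpa using ht.1.le)
  have hpos : 0 < (C⁻¹ • (P.restrict A).map π) (π '' A) := by
    rw [Measure.smul_apply, smul_eq_mul]
    refine ENNReal.mul_pos (ENNReal.inv_ne_zero.2 hC) (ne_of_gt ?_)
    calc 0 < P A := pos_iff_ne_zero.2 hA0
      _ ≤ P (π ⁻¹' (π '' A) ∩ A) := measure_mono fun ω hω => ⟨Set.mem_image_of_mem π hω, hω⟩
      _ ≤ P.restrict A (π ⁻¹' (π '' A)) := Measure.le_restrict_apply _ _
      _ ≤ _ := Measure.le_map_apply hπ.aemeasurable _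
  exact (hpos.trans_le (hle _)).ne'

lemma eventually_prod_le (hα : 1 < α) (hp : ∀ d, 0 ≤ p d) (hpsum : ∑ d, p d = 1) {s : ℝ}
    (hs : s * lyapunov α p < -∑ d, p d * Real.log (p d)) {ω : ℕ → Fin n}
    (hfreq : HasFrequencies p (digits ω)) :
    ∀ᶠ k in atTop, ∏ i ∈ Finset.range k, p (ω i) ≤
      cylinderLength α (word (digits ω) k) ^ s := by
  let a : Fin n → ℝ := fun e => Real.log (p e) - s * Real.log (ratio α (e + 1))
  have hlim := hfreq.tendsto_average a
  have hval : ∑ e, p e * a e = (∑ e, p e * Real.log (p e)) + s * lyapunov α p := by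
    simp only [a, mul_sub, Finset.sum_sub_distrib, mul_left_comm _ s]
    rw [← Finset.mul_sum, sum_mul_log_ratio hα hpsum]
    ring
  have ha : ∀ j, (∑ e : Fin n, if digits ω j = (e : ℕ) + 1 then a e else 0) = a (ω j) := by
    intro j
    simp [digits, ← Fin.ext_iff]
  simp_rw [hval, ha] at hlim
  filter_upwards [hlim.eventually_lt_const (u := 0) (by linarith), eventually_gt_atTop 0]
    with k hk hk0
  have hk0' : (0 : ℝ) < k := by exact_mod_cast hk0
  have hsum : ∑ j ∈ Finset.range k, a (ω j) ≤ 0 := by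
    rw [div_lt_iff₀ hk0', zero_mul] at hk
    exact hk.le
  have hdigit : ∀ e : Fin n, p e ≤ ratio α (e + 1) ^ s * Real.exp (a e) := by
    intro e
    rw [Real.rpow_def_of_pos (ratio_pos hα _), ← Real.exp_add]
    refine (Real.le_exp_log (p e)).trans (le_of_eq ?_)
    congr 1
    ring
  calc ∏ i ∈ Finset.range k, p (ω i)
      ≤ ∏ i ∈ Finset.range k, ratio α (digits ω i) ^ s * Real.exp (a (ω i)) :=
        Finset.prod_le_prod (fun i _ => hp _) fun i _ => hdigit (ω i)
    _ = cylinderLength α (word (digits ω) k) ^ s *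
          Real.exp (∑ j ∈ Finset.range k, a (ω j)) := by
        rw [Finset.prod_mul_distrib, Real.exp_sum, cylinderLength_word,
          Real.finsetProd_rpow _ _ fun i _ => (ratio_pos hα _).le]
    _ ≤ _ := mul_le_of_le_one_right (Real.rpow_nonneg (cylinderLength_pos hα _).le s)
        (Real.exp_le_one_iff.2 hsum)

lemma le_dimH (hα : 1 < α) (hp : ∀ d, 0 ≤ p d) (hpsum : ∑ d, p d = 1) :
    ENNReal.ofReal ((-∑ d, p d * Real.log (p d)) / lyapunov α p) ≤
      dimH {x : ℝ | x ∈ Set.Ioc (0 : ℝ) 1 ∧ ∃ dig : ℕ → ℕ, (∀ i, 1 ≤ dig i) ∧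
        alphaExpansion α dig = x ∧ HasFrequencies p dig} := by
  refine ENNReal.le_of_forall_nnreal_lt fun s hs => ?_
  rcases eq_or_ne s 0 with rfl | hs0
  · simp
  have hs0' : (0 : ℝ) < s := by positivity
  rw [← ENNReal.ofReal_coe_nnreal, ENNReal.ofReal_lt_ofReal_iff_of_nonneg hs0'.le,
    lt_div_iff₀ (lyapunov_pos hα hp hpsum)] at hs
  let ν : Measure (Fin n) := (PMF.ofFintype (fun d => ENNReal.ofReal (p d)) (by
    rw [← ENNReal.ofReal_sum_of_nonneg fun d _ => hp d, hpsum, ENNReal.ofReal_one])).toMeasure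
  have hν : ∀ d, ν {d} = ENNReal.ofReal (p d) := fun d => by
    rw [PMF.toMeasure_apply_singleton _ _ (measurableSet_singleton d), PMF.ofFintype_apply]
  let A : ℕ → Set (ℕ → Fin n) := fun N => {ω | HasFrequencies p (digits ω) ∧
    ∀ k ≥ N, ∏ i ∈ Finset.range k, ν {ω i} ≤
      ENNReal.ofReal (cylinderLength α (word (digits ω) k)) ^ (s : ℝ)}
  obtain ⟨N, hN⟩ : ∃ N, Measure.infinitePi (fun _ : ℕ => ν) (A N) ≠ 0 := by
    by_contra! h
    have h0 := measure_iUnion_null h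
    have h1 : ∀ᵐ ω ∂Measure.infinitePi (fun _ : ℕ => ν), ω ∈ ⋃ N, A N := by
      filter_upwards [ae_hasFrequencies hp ν hν] with ω hω
      obtain ⟨N, hN⟩ := eventually_atTop.1 (eventually_prod_le hα hp hpsum hs hω)
      refine Set.mem_iUnion.2 ⟨N, hω, fun k hk => ?_⟩
      simp_rw [hν]
      rw [ENNReal.ofReal_rpow_of_pos (cylinderLength_pos hα _),
        ← ENNReal.ofReal_prod_of_nonneg fun i _ => hp _]
      exact ENNReal.ofReal_le_ofReal (hN k hk)
    obtain ⟨ω, hω, hω'⟩ := (h1.and (measure_eq_zero_iff_ae_notMem.1 h0)).exists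
    exact hω' hω
  refine (le_dimH_of_hausdorffMeasure_ne_zero
    (hausdorffMeasure_image_pos hα ν hs0' (fun ω hω => hω.2) hN)).trans (dimH_mono ?_)
  rintro _ ⟨ω, hω, rfl⟩
  exact ⟨alphaExpansion_mem hα (one_le_digits ω), digits ω, one_le_digits ω, rfl, hω.1⟩

end AlphaExpansion

/-- Besicovitch–Eggleston type theorem for α-expansions: the set of numbers whose
α-expansion has digit frequency `p d` for each digit `d ∈ {1,…,n}` (encoded by
`d : Fin n`, the digit being `(d : ℕ) + 1`) has Hausdorff dimension
H(𝔭)/(log α · E(𝔭) − log(α−1)). -/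
theorem dimH_frequency_set (α : ℝ) (hα : 1 < α) (n : ℕ) (hn : 1 ≤ n)
    (p : Fin n → ℝ) (hp : ∀ d, p d ∈ Set.Ico (0 : ℝ) 1) (hpsum : ∑ d, p d = 1) :
    dimH {x : ℝ | x ∈ Set.Ioc (0 : ℝ) 1 ∧
        ∃ dig : ℕ → ℕ, (∀ i, 1 ≤ dig i) ∧ alphaExpansion α dig = x ∧
          ∀ d : Fin n,
            Tendsto
              (fun m : ℕ =>
                (((Finset.range m).filter (fun j => dig j = (d : ℕ) + 1)).card : ℝ) / m)
              atTop (nhds (p d))} =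
      ENNReal.ofReal
        ((-∑ d : Fin n, p d * Real.log (p d)) /
          (Real.log α * (∑ d : Fin n, (((d : ℕ) : ℝ) + 1) * p d) - Real.log (α - 1))) :=
  le_antisymm (AlphaExpansion.dimH_le hα (fun d => (hp d).1) hpsum)
    (AlphaExpansion.le_dimH hα (fun d => (hp d).1) hpsum)
end
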